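/- arXiv:2109.08929 — 3 statements merged into one kernel-verified Lean document; each statement's English description precedes it below -/
import Mathlib

section
/- Let 1 < α ≤ 2, α ≠ 2 unless the formula is interpreted with the vanishing factor (α−2). Then for every x ∈ ℝ, ∫_{−1}^{1} |x−y|^α (1−y²)^{−(α−1)/2} dy = α C'_α x² + C'_α + F(x), where F(x) = 0 if |x| ≤ 1 and F(x) = (α(α−1)(α−2)/2) · C_α · ∫_{1}^{|x|} (y²−1)^{−(3−α)/2} (|x|−y)² dy if |x| > 1; here C_α = √π Γ((3-α)/2)/Γ((4-α)/2) and C'_α = ((α-1)π/2)/sin((α-1)π/2). (That is, the identity valid for 2 < α < 3 extends by analytic continuation to 1 < α ≤ 2.) -/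
open MeasureTheory Real

theorem intervalIntegral_comp_of_deriv_nonneg {f f' : ℝ → ℝ} (g : ℝ → ℝ) {a b : ℝ} (hab : a ≤ b)
    (hf : ContinuousOn f (Set.Icc a b)) (hff' : ∀ x ∈ Set.Ioo a b, HasDerivAt f (f' x) x)
    (hf' : ∀ x ∈ Set.Ioo a b, 0 ≤ f' x) :
    ∫ u in f a..f b, g u = ∫ x in a..b, f' x * g (f x) := by
  have hmono : MonotoneOn f (Set.Icc a b) := by
    refine monotoneOn_of_deriv_nonneg (convex_Icc a b) hf ?_ ?_ <;> rw [interior_Icc]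
    · exact fun z hz ↦ (hff' z hz).differentiableAt.differentiableWithinAt
    · intro z hz
      simpa [(hff' z hz).deriv] using hf' z hz
  have hle : f a ≤ f b := hmono (Set.left_mem_Icc.2 hab) (Set.right_mem_Icc.2 hab) hab
  rw [intervalIntegral.integral_of_le hle, intervalIntegral.integral_of_le hab,
    ← integral_Icc_eq_integral_Ioc, ← integral_Icc_eq_integral_Ioc,
    ← integral_Icc_deriv_smul_of_deriv_nonneg hf hff' hf' hab]
  rfl

theorem intervalIntegral_congr_Ioo {f g : ℝ → ℝ} {a b : ℝ} (hab : a ≤ b)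
    (h : ∀ x ∈ Set.Ioo a b, f x = g x) : ∫ x in a..b, f x = ∫ x in a..b, g x := by
  rw [intervalIntegral.integral_of_le hab, intervalIntegral.integral_of_le hab,
    integral_Ioc_eq_integral_Ioo, integral_Ioc_eq_integral_Ioo]
  exact setIntegral_congr_fun measurableSet_Ioo h

theorem integral_rpow_mul_one_sub_rpow {p q : ℝ} (hp : 0 < p) (hq : 0 < q) :
    ∫ x in (0 : ℝ)..1, x ^ (p - 1) * (1 - x) ^ (q - 1) = Gamma p * Gamma q / Gamma (p + q) := by
  have h := Complex.betaIntegral_eq_Gamma_mul_div p q (by simpa) (by simpa)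
  rw [Complex.betaIntegral] at h
  have h2 : ∫ x : ℝ in (0 : ℝ)..1, (x : ℂ) ^ ((p : ℂ) - 1) * (1 - (x : ℂ)) ^ ((q : ℂ) - 1) =
      ((∫ x in (0 : ℝ)..1, x ^ (p - 1) * (1 - x) ^ (q - 1) : ℝ) : ℂ) := by
    rw [← intervalIntegral.integral_ofReal]
    refine intervalIntegral.integral_congr fun x hx ↦ ?_
    rw [Set.uIcc_of_le zero_le_one] at hx
    push_cast [Complex.ofReal_cpow hx.1, Complex.ofReal_cpow (sub_nonneg.2 hx.2)]
    rfl
  rw [h2, ← Complex.ofReal_add, Complex.Gamma_ofReal, Complex.Gamma_ofReal,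
    Complex.Gamma_ofReal] at h
  exact_mod_cast h

theorem integral_one_sub_rpow_mul_one_add_rpow {p q : ℝ} (hp : 0 < p) (hq : 0 < q) :
    ∫ y in (-1 : ℝ)..1, (1 - y) ^ (p - 1) * (1 + y) ^ (q - 1) =
      2 ^ (p + q - 1) * (Gamma p * Gamma q / Gamma (p + q)) := by
  have h := intervalIntegral_comp_of_deriv_nonneg (f := fun u : ℝ ↦ 2 * u - 1) (f' := fun _ ↦ 2)
    (fun y ↦ (1 - y) ^ (p - 1) * (1 + y) ^ (q - 1)) zero_le_one (by fun_prop)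
    (fun x _ ↦ by simpa using ((hasDerivAt_id x).const_mul 2).sub_const 1) (by simp)
  norm_num at h
  rw [h, add_comm p q, mul_comm (Gamma p), ← integral_rpow_mul_one_sub_rpow hq hp,
    ← intervalIntegral.integral_const_mul, ← intervalIntegral.integral_const_mul]
  refine intervalIntegral.integral_congr fun u hu ↦ ?_
  rw [Set.uIcc_of_le zero_le_one] at hu
  have e1 : 1 - (2 * u - 1) = 2 * (1 - u) := by ring
  have e2 : q + p - 1 = 1 + (p - 1) + (q - 1) := by ring
  simp only [e1]
  rw [mul_rpow zero_le_two (sub_nonneg.2 hu.2), mul_rpow zero_le_two hu.1, e2,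
    rpow_add two_pos, rpow_add two_pos, rpow_one]
  ring

theorem intervalIntegrable_one_sub_rpow_mul_one_add_rpow {p q : ℝ} (hp : 0 < p) (hq : 0 < q) :
    IntervalIntegrable (fun y : ℝ ↦ (1 - y) ^ (p - 1) * (1 + y) ^ (q - 1)) volume (-1) 1 := by
  refine intervalIntegral.intervalIntegrable_of_integral_ne_zero ?_
  rw [integral_one_sub_rpow_mul_one_add_rpow hp hq]
  have := Gamma_pos_of_pos hp
  have := Gamma_pos_of_pos hq
  have := Gamma_pos_of_pos (add_pos hp hq)
  positivity

theorem one_sub_sq_rpow {y : ℝ} (hy : y ∈ Set.Icc (-1 : ℝ) 1) (r : ℝ) :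
    (1 - y ^ 2) ^ r = (1 - y) ^ r * (1 + y) ^ r := by
  rw [← mul_rpow (by linarith [hy.2]) (by linarith [hy.1])]
  ring_nf

theorem intervalIntegrable_one_sub_sq_rpow {r : ℝ} (hr : -1 < r) :
    IntervalIntegrable (fun y : ℝ ↦ (1 - y ^ 2) ^ r) volume (-1) 1 := by
  have h := intervalIntegrable_one_sub_rpow_mul_one_add_rpow (p := r + 1) (q := r + 1)
    (by linarith) (by linarith)
  refine h.congr fun y hy ↦ ?_
  rw [Set.uIoc_of_le (by norm_num)] at hy
  simp [one_sub_sq_rpow ⟨hy.1.le, hy.2⟩]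

theorem integral_one_sub_sq_rpow {r : ℝ} (hr : -1 < r) :
    ∫ y in (-1 : ℝ)..1, (1 - y ^ 2) ^ r = √π * Gamma (r + 1) / Gamma (r + 3 / 2) := by
  have h := integral_one_sub_rpow_mul_one_add_rpow (p := r + 1) (q := r + 1)
    (by linarith) (by linarith)
  rw [intervalIntegral.integral_congr (g := fun y : ℝ ↦ (1 - y) ^ (r + 1 - 1) *
    (1 + y) ^ (r + 1 - 1)), h]
  · have hd := Gamma_mul_Gamma_add_half (r + 1)
    have h1 := Gamma_pos_of_pos (show 0 < r + 1 by linarith)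
    have h2 := Gamma_pos_of_pos (show 0 < r + 3 / 2 by linarith)
    have h3 := Gamma_pos_of_pos (show 0 < r + 1 + (r + 1) by linarith)
    have e1 : r + 1 + 1 / 2 = r + 3 / 2 := by ring
    have e2 : 2 * (r + 1) = r + 1 + (r + 1) := by ring
    have e3 : (2 : ℝ) ^ (r + 1 + (r + 1) - 1) * 2 ^ (1 - (r + 1 + (r + 1))) = 1 := by
      rw [← rpow_add two_pos]; simp
    rw [e1, e2] at hd
    rw [mul_div_assoc', div_eq_div_iff h3.ne' h2.ne']
    linear_combination 2 ^ (r + 1 + (r + 1) - 1) * Gamma (r + 1) * hd +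
      Gamma (r + 1) * Gamma (r + 1 + (r + 1)) * √π * e3
  · intro y hy
    rw [Set.uIcc_of_le (by norm_num)] at hy
    simp [one_sub_sq_rpow hy]

theorem integral_abs_rpow_mul_one_sub_sq_rpow {p q : ℝ} (hp : 1 / 2 ≤ p) (hq : 0 < q) :
    ∫ s in (-1 : ℝ)..1, |s| ^ (2 * p - 1) * (1 - s ^ 2) ^ (q - 1) =
      Gamma p * Gamma q / Gamma (p + q) := by
  have hi : IntervalIntegrable (fun s : ℝ ↦ |s| ^ (2 * p - 1) * (1 - s ^ 2) ^ (q - 1))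
      volume (-1) 1 :=
    (intervalIntegrable_one_sub_sq_rpow (by linarith)).continuousOn_mul
      ((continuous_abs.rpow_const fun _ ↦ Or.inr (by linarith)).continuousOn)
  have h0 : ∫ s in (-1 : ℝ)..0, |s| ^ (2 * p - 1) * (1 - s ^ 2) ^ (q - 1) =
      ∫ s in (0 : ℝ)..1, |s| ^ (2 * p - 1) * (1 - s ^ 2) ^ (q - 1) := by
    have h := intervalIntegral.integral_comp_neg (a := 0) (b := 1)
      fun s : ℝ ↦ |s| ^ (2 * p - 1) * (1 - s ^ 2) ^ (q - 1)
    simp only [abs_neg, neg_sq, neg_zero] at h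
    exact h.symm
  rw [← intervalIntegral.integral_add_adjacent_intervals (b := 0)
    (hi.mono_set (by simp [Set.uIcc_of_le, Set.Icc_subset_Icc]))
    (hi.mono_set (by simp [Set.uIcc_of_le, Set.Icc_subset_Icc])), h0,
    ← integral_rpow_mul_one_sub_rpow (by linarith) hq]
  have h := intervalIntegral_comp_of_deriv_nonneg (f := fun u : ℝ ↦ u ^ 2) (f' := fun u ↦ 2 * u)
    (fun y ↦ y ^ (p - 1) * (1 - y) ^ (q - 1)) zero_le_one (by fun_prop)
    (fun x _ ↦ by simpa using hasDerivAt_pow 2 x) (fun x hx ↦ by linarith [hx.1])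
  norm_num at h
  rw [h, ← two_mul, ← intervalIntegral.integral_const_mul]
  refine intervalIntegral_congr_Ioo zero_le_one fun s hs ↦ ?_
  have e : 2 * p - 1 = 2 * (p - 1) + 1 := by ring
  rw [abs_of_pos hs.1, e, rpow_add_one hs.1.ne', rpow_mul hs.1.le, rpow_two]
  ring

theorem integral_abs_sub_rpow_of_abs_lt_one {b x : ℝ} (hb0 : 0 < b) (hb1 : b < 1) (hx : |x| < 1) :
    ∫ y in (-1 : ℝ)..1, |x - y| ^ (2 * b + 1) * (1 - y ^ 2) ^ (-b) =
      Gamma (1 + b) * Gamma (1 - b) * ((2 * b + 1) * x ^ 2 + 1) := by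
  have hx2 : 0 < 1 - x ^ 2 := by
    have := (sq_lt_one_iff_abs_lt_one x).2 hx
    linarith
  set r : ℝ → ℝ := fun s ↦ √(1 - x ^ 2 + x ^ 2 * s ^ 2) with hr
  have hD : ∀ s : ℝ, 0 < 1 - x ^ 2 + x ^ 2 * s ^ 2 := fun s ↦ by positivity
  have hrpos : ∀ s, 0 < r s := fun s ↦ sqrt_pos.2 (hD s)
  have hrsq : ∀ s, r s ^ 2 = 1 - x ^ 2 + x ^ 2 * s ^ 2 := fun s ↦ sq_sqrt (hD s).le
  have hrcont : Continuous r := by fun_prop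
  have hrneg : ∀ s, r (-s) = r s := fun s ↦ by simp [hr]
  have hsub : ∀ s, 0 < r s - x * s := fun s ↦ by
    have : |x * s| < r s := abs_lt_of_sq_lt_sq (by rw [hrsq]; nlinarith) (hrpos s).le
    linarith [(abs_lt.1 this).2]
  have hderiv : ∀ s, HasDerivAt (fun s ↦ x * (1 - s ^ 2) + s * r s)
      ((r s - x * s) ^ 2 / r s) s := fun s ↦ by
    have h1 : HasDerivAt r ((x ^ 2 * (2 * s)) / (2 * r s)) s := by
      refine HasDerivAt.sqrt ?_ (hD s).ne'
      simpa using ((hasDerivAt_pow 2 s).const_mul (x ^ 2)).const_add (1 - x ^ 2)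
    have h2 : HasDerivAt (fun s : ℝ ↦ x * (1 - s ^ 2)) (x * (-(2 * s))) s := by
      simpa using ((hasDerivAt_pow 2 s).const_sub 1).const_mul x
    refine (h2.add ((hasDerivAt_id s).mul h1)).congr_deriv ?_
    have := (hrpos s).ne'
    simp only [id]
    field_simp
    ring
  have hsubst := intervalIntegral_comp_of_deriv_nonneg
    (fun y ↦ |x - y| ^ (2 * b + 1) * (1 - y ^ 2) ^ (-b)) (by norm_num : (-1 : ℝ) ≤ 1)
    (f := fun s ↦ x * (1 - s ^ 2) + s * r s)
    (fun s _ ↦ (hderiv s).continuousAt.continuousWithinAt) (fun s _ ↦ hderiv s)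
    (fun s _ ↦ div_nonneg (sq_nonneg _) (hrpos s).le)
  have hr1 : r 1 = 1 := by simp [hr]
  have hr1' : r (-1) = 1 := by simp [hr]
  norm_num [hr1, hr1'] at hsubst
  set w : ℝ → ℝ := fun s ↦ |s| ^ (2 * b + 1) * (1 - s ^ 2) ^ (-b) with hw
  have hwint : ∀ {g : ℝ → ℝ}, Continuous g →
      IntervalIntegrable (fun s ↦ w s * g s) volume (-1) 1 := fun hg ↦
    ((intervalIntegrable_one_sub_sq_rpow (by linarith)).continuousOn_mul
      ((continuous_abs.rpow_const fun _ ↦ Or.inr (by linarith)).continuousOn)).mul_continuousOn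
      hg.continuousOn
  have hcubic : ∫ y in (-1 : ℝ)..1, |x - y| ^ (2 * b + 1) * (1 - y ^ 2) ^ (-b) =
      ∫ s in (-1 : ℝ)..1, w s * ((r s - x * s) ^ 3 / r s) := by
    rw [hsubst]
    refine intervalIntegral_congr_Ioo (by norm_num) fun s hs ↦ ?_
    have e1 : x - (x * (1 - s ^ 2) + s * r s) = -(s * (r s - x * s)) := by ring
    have e2 : 1 - (x * (1 - s ^ 2) + s * r s) ^ 2 = (1 - s ^ 2) * (r s - x * s) ^ (2 : ℝ) := by
      rw [rpow_two]
      linear_combination (-1) * hrsq s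
    have hs2 : 0 ≤ 1 - s ^ 2 := by nlinarith [hs.1, hs.2]
    rw [e1, e2, abs_neg, abs_mul, abs_of_pos (hsub s), mul_rpow (abs_nonneg s) (hsub s).le,
      mul_rpow hs2 (by positivity [hsub s]), ← rpow_mul (hsub s).le]
    have e3 : (r s - x * s) ^ (2 * b + 1) * (r s - x * s) ^ (2 * -b) = r s - x * s := by
      rw [← rpow_add (hsub s)]
      ring_nf
      simp
    simp only [hw]
    linear_combination (r s - x * s) ^ 2 / r s * |s| ^ (2 * b + 1) * (1 - s ^ 2) ^ (-b) * e3
  have hwneg : ∀ s, w (-s) = w s := fun s ↦ by simp [hw]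
  have hreflect : ∫ s in (-1 : ℝ)..1, w s * ((r s - x * s) ^ 3 / r s) =
      ∫ s in (-1 : ℝ)..1, w s * ((r s + x * s) ^ 3 / r s) := by
    simpa [hwneg, hrneg] using (intervalIntegral.integral_comp_neg (a := -1) (b := 1)
      fun s ↦ w s * ((r s - x * s) ^ 3 / r s)).symm
  have hsum : (∫ s in (-1 : ℝ)..1, w s * ((r s - x * s) ^ 3 / r s)) +
      ∫ s in (-1 : ℝ)..1, w s * ((r s + x * s) ^ 3 / r s) =
      2 * (1 - x ^ 2) * (∫ s in (-1 : ℝ)..1, w s) +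
        8 * x ^ 2 * ∫ s in (-1 : ℝ)..1, w s * s ^ 2 := by
    rw [← intervalIntegral.integral_add, ← intervalIntegral.integral_const_mul,
      ← intervalIntegral.integral_const_mul, ← intervalIntegral.integral_add]
    · refine intervalIntegral.integral_congr fun s _ ↦ ?_
      have := (hrpos s).ne'
      field_simp
      linear_combination 2 * w s * r s * hrsq s
    · simpa using (hwint (continuous_const (y := (1 : ℝ)))).const_mul (2 * (1 - x ^ 2))
    · exact (hwint (by fun_prop)).const_mul _
    · exact hwint (by fun_prop (disch := exact fun s ↦ (hrpos s).ne'))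
    · exact hwint (by fun_prop (disch := exact fun s ↦ (hrpos s).ne'))
  have hw0 : ∫ s in (-1 : ℝ)..1, w s = Gamma (1 + b) * Gamma (1 - b) := by
    have h := integral_abs_rpow_mul_one_sub_sq_rpow (p := 1 + b) (q := 1 - b) (by linarith)
      (by linarith)
    have e1 : 2 * (1 + b) - 1 = 2 * b + 1 := by ring
    have e2 : 1 - b - 1 = -b := by ring
    have e3 : 1 + b + (1 - b) = 2 := by ring
    rw [e1, e2, e3, Gamma_two, div_one] at h
    exact h
  have hw2 : ∫ s in (-1 : ℝ)..1, w s * s ^ 2 = (1 + b) * Gamma (1 + b) * Gamma (1 - b) / 2 := by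
    have h := integral_abs_rpow_mul_one_sub_sq_rpow (p := 2 + b) (q := 1 - b) (by linarith)
      (by linarith)
    have e1 : 2 * (2 + b) - 1 = 2 * b + 1 + 2 := by ring
    have e2 : 1 - b - 1 = -b := by ring
    have e3 : 2 + b + (1 - b) = 2 + 1 := by ring
    have e4 : 2 + b = 1 + b + 1 := by ring
    rw [e1, e2, e3, e4, Gamma_add_one two_ne_zero, Gamma_two,
      Gamma_add_one (by linarith : (0 : ℝ) < 1 + b).ne', mul_one] at h
    rw [← h]
    refine intervalIntegral.integral_congr fun s _ ↦ ?_
    simp only [hw]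
    rw [rpow_add_of_nonneg (abs_nonneg s) (by linarith) zero_le_two, rpow_two, sq_abs]
    ring
  rw [hcubic]
  rw [← hreflect, hw0, hw2] at hsum
  linear_combination hsum / 2

theorem integral_sub_rpow_mul_one_sub_sq_rpow {b z : ℝ} (hb : b < 1) (hz : 1 < z) :
    ∫ y in (-1 : ℝ)..1, (z - y) ^ (2 * b - 2) * (1 - y ^ 2) ^ (-b) =
      √π * Gamma (1 - b) / Gamma (3 / 2 - b) * (z ^ 2 - 1) ^ (b - 1) := by
  have hz2 : 0 < z ^ 2 - 1 := by nlinarith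
  have hpos : ∀ t ∈ Set.Icc (-1 : ℝ) 1, 0 < z + t := fun t ht ↦ by linarith [ht.1]
  have hderiv : ∀ t ∈ Set.Icc (-1 : ℝ) 1, HasDerivAt (fun t ↦ (1 + z * t) / (z + t))
      ((z ^ 2 - 1) / (z + t) ^ 2) t := fun t ht ↦ by
    have h1 : HasDerivAt (fun t ↦ 1 + z * t) z t := by
      simpa using ((hasDerivAt_id t).const_mul z).const_add 1
    refine (h1.div ((hasDerivAt_id t).const_add z) (hpos t ht).ne').congr_deriv ?_
    simp only [id]
    ring
  have hsubst := intervalIntegral_comp_of_deriv_nonneg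
    (fun y ↦ (z - y) ^ (2 * b - 2) * (1 - y ^ 2) ^ (-b)) (by norm_num : (-1 : ℝ) ≤ 1)
    (f := fun t ↦ (1 + z * t) / (z + t))
    (fun t ht ↦ (hderiv t ht).continuousAt.continuousWithinAt)
    (fun t ht ↦ hderiv t (Set.Ioo_subset_Icc_self ht))
    (fun t _ ↦ div_nonneg hz2.le (sq_nonneg _))
  have e1 : (1 + z * 1) / (z + 1) = 1 := by
    rw [div_eq_one_iff_eq (by linarith)]; ring
  have e2 : (1 + z * -1) / (z + -1) = -1 := by
    rw [div_eq_iff (by linarith)]; ring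
  have h := integral_one_sub_sq_rpow (r := -b) (by linarith)
  have e3 : -b + 1 = 1 - b := by ring
  have e4 : -b + 3 / 2 = 3 / 2 - b := by ring
  rw [e3, e4] at h
  rw [e1, e2] at hsubst
  rw [hsubst, ← h, ← intervalIntegral.integral_mul_const]
  refine intervalIntegral_congr_Ioo (by norm_num) fun t ht ↦ ?_
  have hp := hpos t (Set.Ioo_subset_Icc_self ht)
  have ht2 : 0 ≤ 1 - t ^ 2 := by nlinarith [ht.1, ht.2]
  have e5 : z - (1 + z * t) / (z + t) = (z ^ 2 - 1) / (z + t) := by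
    field_simp
    ring
  have e6 : 1 - ((1 + z * t) / (z + t)) ^ 2 = (1 - t ^ 2) * ((z ^ 2 - 1) / (z + t) ^ (2 : ℝ)) := by
    rw [rpow_two]
    field_simp
    ring
  rw [e5, e6, mul_rpow ht2 (by positivity), div_rpow hz2.le hp.le, div_rpow hz2.le (by positivity),
    ← rpow_mul hp.le]
  have e7 : (z ^ 2 - 1) * (z ^ 2 - 1) ^ (2 * b - 2) * (z ^ 2 - 1) ^ (-b) =
      (z ^ 2 - 1) ^ (b - 1) := by
    rw [show b - 1 = 1 + (2 * b - 2) + -b by ring, rpow_add hz2, rpow_add hz2, rpow_one]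
  have e8 : (z + t) ^ 2 * (z + t) ^ (2 * b - 2) * (z + t) ^ (2 * -b) = 1 := by
    rw [← rpow_two, ← rpow_add hp, ← rpow_add hp]
    ring_nf
    simp
  rw [← e7]
  have h1 := (rpow_pos_of_pos hp (2 * b - 2)).ne'
  have h2 := (rpow_pos_of_pos hp (2 * -b)).ne'
  calc _ = (1 - t ^ 2) ^ (-b) * ((z ^ 2 - 1) * (z ^ 2 - 1) ^ (2 * b - 2) * (z ^ 2 - 1) ^ (-b)) /
        ((z + t) ^ 2 * (z + t) ^ (2 * b - 2) * (z + t) ^ (2 * -b)) := by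
        field_simp
    _ = _ := by rw [e8, div_one]

theorem sub_rpow_eq_taylor_add_integral (b : ℝ) {x y : ℝ} (hx : 1 ≤ x) (hy : y < 1) :
    (x - y) ^ (2 * b + 1) = (1 - y) ^ (2 * b + 1) + (2 * b + 1) * (x - 1) * (1 - y) ^ (2 * b) +
      (2 * b + 1) * b * (x - 1) ^ 2 * (1 - y) ^ (2 * b - 1) +
      (2 * b + 1) * b * (2 * b - 1) * ∫ z in (1 : ℝ)..x, (z - y) ^ (2 * b - 2) * (x - z) ^ 2 := by
  have hpos : ∀ z ∈ Set.uIcc 1 x, 0 < z - y := fun z hz ↦ by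
    rw [Set.uIcc_of_le hx] at hz
    linarith [hz.1]
  have hpow : ∀ p : ℝ, ∀ z ∈ Set.uIcc 1 x,
      HasDerivAt (fun z ↦ (z - y) ^ p) (p * (z - y) ^ (p - 1)) z := fun p z hz ↦ by
    simpa using ((hasDerivAt_id z).sub_const y).rpow_const (p := p) (Or.inl (hpos z hz).ne')
  have hderiv : ∀ z ∈ Set.uIcc 1 x, HasDerivAt (fun z ↦ (z - y) ^ (2 * b + 1) +
      (2 * b + 1) * ((z - y) ^ (2 * b) * (x - z)) +
      (2 * b + 1) * b * ((z - y) ^ (2 * b - 1) * (x - z) ^ 2))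
      ((2 * b + 1) * b * (2 * b - 1) * ((z - y) ^ (2 * b - 2) * (x - z) ^ 2)) z := fun z hz ↦ by
    have h1 : HasDerivAt (fun z ↦ x - z) (-1) z := by
      simpa using (hasDerivAt_id z).const_sub x
    have h2 : HasDerivAt (fun z ↦ (x - z) ^ 2) (2 * (x - z) * (-1)) z := by
      simpa using h1.fun_pow 2
    refine (((hpow (2 * b + 1) z hz).add
      (((hpow (2 * b) z hz).mul h1).const_mul (2 * b + 1))).add
      (((hpow (2 * b - 1) z hz).mul h2).const_mul ((2 * b + 1) * b))).congr_deriv ?_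
    have e1 : 2 * b + 1 - 1 = 2 * b := by ring
    have e2 : 2 * b - 1 - 1 = 2 * b - 2 := by ring
    rw [e1, e2]
    ring
  have hcont : ContinuousOn (fun z ↦ (z - y) ^ (2 * b - 2) * (x - z) ^ 2) (Set.uIcc 1 x) :=
    ContinuousOn.mul (fun z hz ↦ (hpow _ z hz).continuousAt.continuousWithinAt) (by fun_prop)
  have h := intervalIntegral.integral_eq_sub_of_hasDerivAt hderiv
    (hcont.intervalIntegrable.const_mul _)
  rw [intervalIntegral.integral_const_mul] at h
  rw [h]
  ring

theorem intervalIntegrable_sub_rpow_mul_one_sub_sq_rpow {b z : ℝ} (hb : b < 1) (hz : 1 < z) :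
    IntervalIntegrable (fun y ↦ (z - y) ^ (2 * b - 2) * (1 - y ^ 2) ^ (-b)) volume (-1) 1 := by
  refine (intervalIntegrable_one_sub_sq_rpow (by linarith)).continuousOn_mul ?_
  refine ContinuousOn.rpow_const (by fun_prop) fun y hy ↦ Or.inl ?_
  rw [Set.uIcc_of_le (by norm_num)] at hy
  linarith [hy.2]

theorem intervalIntegrable_sq_sub_one_rpow {b x : ℝ} (hb : 0 < b) (hx : 1 ≤ x) :
    IntervalIntegrable (fun z ↦ (z ^ 2 - 1) ^ (b - 1)) volume 1 x := by
  have h1 : IntervalIntegrable (fun z : ℝ ↦ (z - 1) ^ (b - 1)) volume 1 x := by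
    have := (intervalIntegral.intervalIntegrable_rpow' (r := b - 1) (a := 0) (b := x - 1)
      (by linarith)).comp_sub_right 1
    simpa using this
  have h2 : ContinuousOn (fun z : ℝ ↦ (z + 1) ^ (b - 1)) (Set.uIcc 1 x) := by
    refine ContinuousOn.rpow_const (by fun_prop) fun z hz ↦ Or.inl ?_
    rw [Set.uIcc_of_le hx] at hz
    linarith [hz.1]
  refine (h1.mul_continuousOn h2).congr fun z hz ↦ ?_
  rw [Set.uIoc_of_le hx] at hz
  rw [← mul_rpow (by linarith [hz.1]) (by linarith [hz.1])]
  ring_nf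

theorem integrableOn_kernel_prod {b x : ℝ} (hb0 : 0 < b) (hb1 : b < 1) (hx : 1 ≤ x) :
    IntegrableOn (Function.uncurry fun y z : ℝ ↦
      (z - y) ^ (2 * b - 2) * (1 - y ^ 2) ^ (-b) * (x - z) ^ 2)
      (Set.uIoc (-1) 1 ×ˢ Set.uIoc 1 x) := by
  rw [IntegrableOn, Measure.volume_eq_prod, ← Measure.prod_restrict, integrable_prod_iff'
    (Measurable.aestronglyMeasurable (by unfold Function.uncurry; fun_prop))]
  rw [Set.uIoc_of_le (by norm_num : (-1 : ℝ) ≤ 1), Set.uIoc_of_le hx]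
  simp only [Function.uncurry]
  constructor
  · refine ae_restrict_of_forall_mem measurableSet_Ioc fun z hz ↦ ?_
    have := (intervalIntegrable_sub_rpow_mul_one_sub_sq_rpow hb1 hz.1).mul_const ((x - z) ^ 2)
    rwa [intervalIntegrable_iff_integrableOn_Ioc_of_le (by norm_num)] at this
  · have h := (intervalIntegrable_sq_sub_one_rpow hb0 hx).continuousOn_mul
      (g := fun z ↦ √π * Gamma (1 - b) / Gamma (3 / 2 - b) * (x - z) ^ 2) (by fun_prop)
    rw [intervalIntegrable_iff_integrableOn_Ioc_of_le hx] at h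
    refine h.congr_fun (fun z hz ↦ ?_) measurableSet_Ioc
    have hn : ∫ y in Set.Ioc (-1 : ℝ) 1, ‖(z - y) ^ (2 * b - 2) * (1 - y ^ 2) ^ (-b) *
        (x - z) ^ 2‖ = ∫ y in Set.Ioc (-1 : ℝ) 1, (z - y) ^ (2 * b - 2) * (1 - y ^ 2) ^ (-b) *
        (x - z) ^ 2 := by
      refine setIntegral_congr_fun measurableSet_Ioc fun y hy ↦ norm_of_nonneg ?_
      have h1 : 0 ≤ z - y := by linarith [hz.1, hy.2]
      have h2 : 0 ≤ 1 - y ^ 2 := by nlinarith [hy.1, hy.2]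
      positivity
    simp only
    rw [hn, ← intervalIntegral.integral_of_le (by norm_num), intervalIntegral.integral_mul_const,
      integral_sub_rpow_mul_one_sub_sq_rpow hb1 hz.1]
    ring

theorem integral_abs_sub_rpow_of_one_le {b x : ℝ} (hb0 : 0 < b) (hb1 : b < 1) (hx : 1 ≤ x) :
    ∫ y in (-1 : ℝ)..1, |x - y| ^ (2 * b + 1) * (1 - y ^ 2) ^ (-b) =
      Gamma (1 + b) * Gamma (1 - b) * ((2 * b + 1) * x ^ 2 + 1) +
      (2 * b + 1) * b * (2 * b - 1) * (√π * Gamma (1 - b) / Gamma (3 / 2 - b)) *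
        ∫ z in (1 : ℝ)..x, (z ^ 2 - 1) ^ (b - 1) * (x - z) ^ 2 := by
  have hprod := integrableOn_kernel_prod hb0 hb1 hx
  have hR : IntervalIntegrable (fun y ↦ ∫ z in (1 : ℝ)..x,
      (z - y) ^ (2 * b - 2) * (1 - y ^ 2) ^ (-b) * (x - z) ^ 2) volume (-1) 1 := by
    have h := hprod
    rw [IntegrableOn, Measure.volume_eq_prod, ← Measure.prod_restrict] at h
    have h := h.integral_prod_left
    rw [Set.uIoc_of_le (by norm_num : (-1 : ℝ) ≤ 1), Set.uIoc_of_le hx] at h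
    rw [intervalIntegrable_iff_integrableOn_Ioc_of_le (by norm_num)]
    simp only [intervalIntegral.integral_of_le hx]
    exact h
  have hRint : ∫ y in (-1 : ℝ)..1, ∫ z in (1 : ℝ)..x,
      (z - y) ^ (2 * b - 2) * (1 - y ^ 2) ^ (-b) * (x - z) ^ 2 =
      √π * Gamma (1 - b) / Gamma (3 / 2 - b) *
        ∫ z in (1 : ℝ)..x, (z ^ 2 - 1) ^ (b - 1) * (x - z) ^ 2 := by
    rw [intervalIntegral_intervalIntegral_swap hprod, ← intervalIntegral.integral_const_mul]
    refine intervalIntegral_congr_Ioo hx fun z hz ↦ ?_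
    rw [intervalIntegral.integral_mul_const, integral_sub_rpow_mul_one_sub_sq_rpow hb1 hz.1]
    ring
  have hJ := fun p : ℝ ↦ fun hp : 0 < p ↦
    integral_one_sub_rpow_mul_one_add_rpow (q := 1 - b) hp (by linarith)
  have hJi := fun p : ℝ ↦ fun hp : 0 < p ↦
    intervalIntegrable_one_sub_rpow_mul_one_add_rpow (q := 1 - b) hp (by linarith)
  have i0 := hJi (b + 1 + 1) (by linarith)
  have i1 := (hJi (b + 1) (by linarith)).const_mul ((2 * b + 1) * (x - 1))
  have i2 := (hJi b hb0).const_mul ((2 * b + 1) * b * (x - 1) ^ 2)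
  have i3 := hR.const_mul ((2 * b + 1) * b * (2 * b - 1))
  have hsplit : ∫ y in (-1 : ℝ)..1, |x - y| ^ (2 * b + 1) * (1 - y ^ 2) ^ (-b) =
      ∫ y in (-1 : ℝ)..1, ((1 - y) ^ (b + 1 + 1 - 1) * (1 + y) ^ (1 - b - 1) +
        (2 * b + 1) * (x - 1) * ((1 - y) ^ (b + 1 - 1) * (1 + y) ^ (1 - b - 1)) +
        (2 * b + 1) * b * (x - 1) ^ 2 * ((1 - y) ^ (b - 1) * (1 + y) ^ (1 - b - 1)) +
        (2 * b + 1) * b * (2 * b - 1) * ∫ z in (1 : ℝ)..x,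
          (z - y) ^ (2 * b - 2) * (1 - y ^ 2) ^ (-b) * (x - z) ^ 2) := by
    refine intervalIntegral_congr_Ioo (by norm_num) fun y hy ↦ ?_
    have hy1 : 0 < 1 - y := by linarith [hy.2]
    have hR' : ∫ z in (1 : ℝ)..x, (z - y) ^ (2 * b - 2) * (1 - y ^ 2) ^ (-b) * (x - z) ^ 2 =
        (1 - y ^ 2) ^ (-b) * ∫ z in (1 : ℝ)..x, (z - y) ^ (2 * b - 2) * (x - z) ^ 2 := by
      rw [← intervalIntegral.integral_const_mul]
      congr 1
      ext z
      ring
    have e0 : 1 - b - 1 = -b := by ring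
    have e1 : b + 1 + 1 - 1 = 2 * b + 1 + -b := by ring
    have e2 : b + 1 - 1 = 2 * b + -b := by ring
    have e3 : b - 1 = 2 * b - 1 + -b := by ring
    rw [abs_of_pos (by linarith), sub_rpow_eq_taylor_add_integral b hx hy.2, hR', e0, e1, e2, e3,
      rpow_add hy1 (2 * b + 1) (-b), rpow_add hy1 (2 * b) (-b), rpow_add hy1 (2 * b - 1) (-b),
      one_sub_sq_rpow (Set.Ioo_subset_Icc_self hy)]
    ring
  have e0 : b + 1 + 1 + (1 - b) = 2 + 1 := by ring
  have e1 : b + 1 + (1 - b) = 2 := by ring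
  have e2 : b + (1 - b) = 1 := by ring
  rw [hsplit, intervalIntegral.integral_add ((i0.add i1).add i2) i3,
    intervalIntegral.integral_add (i0.add i1) i2, intervalIntegral.integral_add i0 i1,
    intervalIntegral.integral_const_mul, intervalIntegral.integral_const_mul,
    intervalIntegral.integral_const_mul, hRint, hJ _ (by linarith), hJ _ (by linarith), hJ _ hb0,
    e0, e1, e2, add_comm 1 b, Gamma_add_one (by linarith : (0 : ℝ) < b + 1).ne',
    Gamma_add_one hb0.ne', Gamma_add_one two_ne_zero, Gamma_two, Gamma_one]
  norm_num
  ring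

/-- Lemma 3.2, first part. For `1 < α ≤ 2` (at `α = 2` the vanishing factor `α - 2` makes the extra term vanish) and all `x ∈ ℝ`,
`∫_{-1}^{1} |x-y|^α (1-y²)^{-(α-1)/2} dy = α C'_α x² + C'_α + F(x)`,
where `F(x) = 0` for `|x| ≤ 1` and
`F(x) = (α(α-1)(α-2)/2) C_α ∫_1^{|x|} (y²-1)^{-(3-α)/2} (|x|-y)² dy` for `|x| > 1`. -/
theorem integral_abs_rpow_kernel_one_lt_alpha_le_two
    (α : ℝ) (hα1 : 1 < α) (hα2 : α ≤ 2)
    (Cα Cα' : ℝ)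
    (hC : Cα = Real.sqrt π * Real.Gamma ((3 - α) / 2) / Real.Gamma ((4 - α) / 2))
    (hC' : Cα' = ((α - 1) * π / 2) / Real.sin ((α - 1) * π / 2)) :
    ∀ x : ℝ, (∫ y in (-1 : ℝ)..1, |x - y| ^ α * (1 - y ^ 2) ^ (-(α - 1) / 2)) =
      α * Cα' * x ^ 2 + Cα' +
        (if |x| ≤ 1 then 0 else
          α * (α - 1) * (α - 2) / 2 * Cα *
            ∫ y in (1 : ℝ)..|x|, (y ^ 2 - 1) ^ (-(3 - α) / 2) * (|x| - y) ^ 2) := by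
  obtain ⟨b, rfl⟩ : ∃ b, α = 2 * b + 1 := ⟨(α - 1) / 2, by ring⟩
  have hb0 : 0 < b := by linarith
  have hb1 : b < 1 := by linarith
  have e1 : -(2 * b + 1 - 1) / 2 = -b := by ring
  have e2 : -(3 - (2 * b + 1)) / 2 = b - 1 := by ring
  have e3 : (3 - (2 * b + 1)) / 2 = 1 - b := by ring
  have e4 : (4 - (2 * b + 1)) / 2 = 3 / 2 - b := by ring
  have e5 : (2 * b + 1 - 1) * π / 2 = π * b := by ring
  rw [e3, e4] at hC
  have hC'' : Cα' = Gamma (1 + b) * Gamma (1 - b) := by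
    rw [hC', e5, add_comm, Gamma_add_one hb0.ne', mul_assoc, Gamma_mul_Gamma_one_sub]
    ring
  intro x
  rw [e1, e2]
  have habs : ∫ y in (-1 : ℝ)..1, |x - y| ^ (2 * b + 1) * (1 - y ^ 2) ^ (-b) =
      ∫ y in (-1 : ℝ)..1, |(|x|) - y| ^ (2 * b + 1) * (1 - y ^ 2) ^ (-b) := by
    rcases abs_cases x with ⟨hx, _⟩ | ⟨hx, _⟩ <;> rw [hx]
    have h := intervalIntegral.integral_comp_neg (a := -1) (b := 1)
      fun y : ℝ ↦ |x - y| ^ (2 * b + 1) * (1 - y ^ 2) ^ (-b)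
    rw [neg_neg] at h
    rw [← h]
    refine intervalIntegral.integral_congr fun y _ ↦ ?_
    simp only [neg_sq]
    rw [← abs_neg (x - -y), neg_sub, sub_eq_add_neg, add_comm, ← sub_eq_add_neg, neg_sub_left,
      neg_add_rev, ← sub_eq_add_neg]
  rw [habs, ← sq_abs x]
  rcases lt_or_ge |x| 1 with hx | hx
  · rw [integral_abs_sub_rpow_of_abs_lt_one hb0 hb1 (by rwa [abs_abs]), if_pos hx.le, hC'']
    ring
  · rw [integral_abs_sub_rpow_of_one_le hb0 hb1 hx, hC, hC'']
    split_ifs with h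
    · rw [le_antisymm h hx, intervalIntegral.integral_same]
      ring
    · ring
end

section
/- Let 2 < α < 3. Then for every x ∈ ℝ with |x| ≠ 1, ∫_{−1}^{1} |x−y|^{α−2} (1−y²)^{−(α−1)/2} dy = c_α if |x| < 1, and = c_α + (α−2) C_α ∫_{1}^{|x|} (y²−1)^{−(3−α)/2} dy if |x| > 1, where c_α = π / sin((α−1)π/2) and C_α = √π Γ((3-α)/2)/Γ((4-α)/2). -/
open MeasureTheory Real

lemma setIntegral_eq_of_bijOn {φ φ' : ℝ → ℝ} {s t : Set ℝ} (hs : MeasurableSet s)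
    (hφ : ∀ x ∈ s, HasDerivAt φ (φ' x) x) (hb : Set.BijOn φ s t) (g : ℝ → ℝ) :
    ∫ x in t, g x = ∫ x in s, |φ' x| * g (φ x) := by
  rw [← hb.image_eq]
  exact integral_image_eq_integral_abs_deriv_smul hs (fun x hx => (hφ x hx).hasDerivWithinAt)
    hb.injOn g

lemma setIntegral_rpow_mul_one_sub_rpow {a b : ℝ} (ha : 0 < a) (hb : 0 < b) :
    ∫ u in Set.Ioo (0 : ℝ) 1, u ^ (a - 1) * (1 - u) ^ (b - 1) =
      Gamma a * Gamma b / Gamma (a + b) := by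
  have h := ProbabilityTheory.beta_eq_betaIntegralReal a b ha hb
  rw [ProbabilityTheory.beta] at h
  rw [h, Complex.betaIntegral, intervalIntegral.integral_of_le zero_le_one,
    integral_Ioc_eq_integral_Ioo]
  have : ∫ u in Set.Ioo (0 : ℝ) 1, (u : ℂ) ^ ((a : ℂ) - 1) * (1 - (u : ℂ)) ^ ((b : ℂ) - 1) =
      ∫ u in Set.Ioo (0 : ℝ) 1, ((u ^ (a - 1) * (1 - u) ^ (b - 1) : ℝ) : ℂ) := by
    refine setIntegral_congr_fun measurableSet_Ioo fun u hu => ?_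
    have h1 : (0 : ℝ) ≤ 1 - u := by linarith [hu.2]
    push_cast [Complex.ofReal_cpow hu.1.le, Complex.ofReal_cpow h1]
    rfl
  rw [this, integral_complex_ofReal, Complex.ofReal_re]

lemma integrableOn_one_sub_sq_rpow {p : ℝ} (hp : -1 < p) (hp0 : p ≤ 0) :
    IntegrableOn (fun y : ℝ => (1 - y ^ 2) ^ p) (Set.Ioo (-1) 1) := by
  have h1 : IntegrableOn (fun y : ℝ => (1 - y) ^ p) (Set.Ioo (-1) 1) := by
    have := (intervalIntegral.intervalIntegrable_rpow' (a := 2) (b := 0) hp).comp_sub_left 1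
    norm_num at this
    rwa [intervalIntegrable_iff_integrableOn_Ioo_of_le (by norm_num)] at this
  have h2 : IntegrableOn (fun y : ℝ => (1 + y) ^ p) (Set.Ioo (-1) 1) := by
    have := (intervalIntegral.intervalIntegrable_rpow' (a := 0) (b := 2) hp).comp_add_left 1
    norm_num at this
    rwa [intervalIntegrable_iff_integrableOn_Ioo_of_le (by norm_num)] at this
  refine Integrable.mono' (h1.add h2)
    (Measurable.aestronglyMeasurable (by fun_prop)) ?_
  refine (ae_restrict_mem measurableSet_Ioo).mono fun y hy => ?_
  have a1 : 0 < 1 - y := by linarith [hy.2]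
  have a2 : 0 < 1 + y := by linarith [hy.1]
  have a3 : 0 < 1 - y ^ 2 := by nlinarith
  rw [norm_of_nonneg (by positivity), Pi.add_apply]
  rcases le_total 0 y with h | h
  · have : (1 - y ^ 2) ^ p ≤ (1 - y) ^ p := rpow_le_rpow_of_nonpos a1 (by nlinarith) hp0
    have : 0 ≤ (1 + y) ^ p := by positivity
    linarith
  · have : (1 - y ^ 2) ^ p ≤ (1 + y) ^ p := rpow_le_rpow_of_nonpos a2 (by nlinarith) hp0
    have : 0 ≤ (1 - y) ^ p := by positivity
    linarith

lemma one_add_mul_pos {c t : ℝ} (hc : |c| < 1) (ht : t ∈ Set.Ioo (-1 : ℝ) 1) :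
    0 < 1 + c * t := by
  have h := abs_lt.mp (abs_mul c t ▸ mul_lt_one_of_nonneg_of_lt_one_left (abs_nonneg c) hc
    (abs_lt.mpr ht).le)
  linarith [h.1]

lemma mapsTo_moebius {c : ℝ} (hc : |c| < 1) :
    Set.MapsTo (fun t : ℝ => (c + t) / (1 + c * t)) (Set.Ioo (-1) 1) (Set.Ioo (-1) 1) := by
  intro t ht
  have h := one_add_mul_pos hc ht
  obtain ⟨c1, c2⟩ := abs_lt.mp hc
  constructor
  · rw [lt_div_iff₀ h]
    nlinarith [mul_pos (by linarith : 0 < 1 + c) (by linarith [ht.1] : 0 < 1 + t)]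
  · rw [div_lt_iff₀ h]
    nlinarith [mul_pos (by linarith : 0 < 1 - c) (by linarith [ht.2] : 0 < 1 - t)]

lemma moebius_neg_moebius {c : ℝ} (hc : |c| < 1) {t : ℝ} (ht : t ∈ Set.Ioo (-1 : ℝ) 1) :
    (-c + (c + t) / (1 + c * t)) / (1 + -c * ((c + t) / (1 + c * t))) = t := by
  have h := one_add_mul_pos hc ht
  have h' : 1 - c ^ 2 ≠ 0 := by
    have := (sq_lt_one_iff_abs_lt_one c).mpr hc
    linarith
  have e : 1 + -c * ((c + t) / (1 + c * t)) = (1 - c ^ 2) / (1 + c * t) := by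
    field_simp
    ring
  rw [e]
  field_simp
  ring

lemma bijOn_moebius {c : ℝ} (hc : |c| < 1) :
    Set.BijOn (fun t : ℝ => (c + t) / (1 + c * t)) (Set.Ioo (-1) 1) (Set.Ioo (-1) 1) := by
  have hc' : |-c| < 1 := by rwa [abs_neg]
  refine Set.InvOn.bijOn (f' := fun t : ℝ => (-c + t) / (1 + -c * t))
    ⟨fun t ht => moebius_neg_moebius hc ht, fun t ht => ?_⟩ (mapsTo_moebius hc)
    (mapsTo_moebius hc')
  simpa using moebius_neg_moebius hc' ht

lemma setIntegral_mul_one_sub_sq_rpow_moebius {c : ℝ} (hc : |c| < 1) (p : ℝ) (g : ℝ → ℝ) :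
    ∫ y in Set.Ioo (-1 : ℝ) 1, g y * (1 - y ^ 2) ^ p =
      ∫ t in Set.Ioo (-1 : ℝ) 1, (1 - c ^ 2) ^ (p + 1) * (1 + c * t) ^ (-2 * p - 2) *
        g ((c + t) / (1 + c * t)) * (1 - t ^ 2) ^ p := by
  have hc2 : 0 < 1 - c ^ 2 := by
    have := (sq_lt_one_iff_abs_lt_one c).mpr hc
    linarith
  rw [setIntegral_eq_of_bijOn (φ' := fun t => (1 - c ^ 2) / (1 + c * t) ^ 2) measurableSet_Ioo ?_
    (bijOn_moebius hc)]
  · refine setIntegral_congr_fun measurableSet_Ioo fun t ht => ?_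
    have h := one_add_mul_pos hc ht
    have ht2 : 0 < 1 - t ^ 2 := by nlinarith [ht.1, ht.2]
    have e : 1 - ((c + t) / (1 + c * t)) ^ 2 = (1 - c ^ 2) * (1 - t ^ 2) / (1 + c * t) ^ 2 := by
      field_simp
      ring
    simp only [e]
    rw [abs_of_pos (by positivity), div_rpow (by positivity) (by positivity),
      mul_rpow hc2.le ht2.le, rpow_add hc2, rpow_one, rpow_sub h, ← rpow_natCast (1 + c * t),
      ← rpow_mul h.le, neg_mul, rpow_neg h.le]
    push_cast
    field_simp
  · intro t ht
    have h := one_add_mul_pos hc ht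
    have := ((hasDerivAt_id t).const_add c).div (((hasDerivAt_id t).const_mul c).const_add 1) h.ne'
    refine this.congr_deriv ?_
    norm_num
    ring

lemma bijOn_mul_sq_div {c : ℝ} (hc : |c| < 1) :
    Set.BijOn (fun t : ℝ => (1 - c ^ 2) * t ^ 2 / (1 - c ^ 2 * t ^ 2)) (Set.Ioo 0 1)
      (Set.Ioo 0 1) := by
  have hc2 : 0 < 1 - c ^ 2 := by
    have := (sq_lt_one_iff_abs_lt_one c).mpr hc
    linarith
  refine Set.InvOn.bijOn (f' := fun u : ℝ => √(u / (1 - c ^ 2 + c ^ 2 * u)))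
    ⟨fun t ht => ?_, fun u hu => ?_⟩ (fun t ht => ?_) (fun u hu => ?_)
  · have h : 0 < 1 - c ^ 2 * t ^ 2 := by nlinarith [ht.1, ht.2, sq_nonneg c, sq_nonneg t]
    simp only
    rw [sqrt_eq_iff_mul_self_eq_of_pos ht.1]
    have : 1 - c ^ 2 + c ^ 2 * ((1 - c ^ 2) * t ^ 2 / (1 - c ^ 2 * t ^ 2)) =
      (1 - c ^ 2) / (1 - c ^ 2 * t ^ 2) := by
        field_simp
        ring
    rw [this]
    rw [← pow_two, eq_div_iff (div_pos hc2 h).ne']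
    field_simp
  · have h : 0 < 1 - c ^ 2 + c ^ 2 * u := by nlinarith [hu.1, sq_nonneg c]
    have := hu.1
    simp only
    rw [sq_sqrt (by positivity)]
    have : 1 - c ^ 2 * (u / (1 - c ^ 2 + c ^ 2 * u)) = (1 - c ^ 2) / (1 - c ^ 2 + c ^ 2 * u) := by
      field_simp
      ring
    rw [this]
    field_simp
  · have h : 0 < 1 - c ^ 2 * t ^ 2 := by nlinarith [ht.1, ht.2, sq_nonneg c, sq_nonneg t]
    have := ht.1
    refine ⟨by positivity, ?_⟩
    rw [div_lt_one h]
    nlinarith [ht.2]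
  · have h : 0 < 1 - c ^ 2 + c ^ 2 * u := by nlinarith [hu.1, sq_nonneg c]
    have := hu.1
    refine ⟨by positivity, ?_⟩
    rw [sqrt_lt' one_pos, div_lt_iff₀ h]
    nlinarith [hu.2]

lemma setIntegral_rpow_mul_one_sub_sq_rpow_mul {c : ℝ} (hc : |c| < 1) {a b : ℝ} (ha : 0 < a)
    (hb : 0 < b) :
    ∫ t in Set.Ioo (0 : ℝ) 1, 2 * (1 - c ^ 2) ^ a * t ^ (2 * a - 1) * (1 - t ^ 2) ^ (b - 1) *
        (1 - c ^ 2 * t ^ 2) ^ (-a - b) = Gamma a * Gamma b / Gamma (a + b) := by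
  have hc2 : 0 < 1 - c ^ 2 := by
    have := (sq_lt_one_iff_abs_lt_one c).mpr hc
    linarith
  have hden : ∀ t ∈ Set.Ioo (0 : ℝ) 1, 0 < 1 - c ^ 2 * t ^ 2 := fun t ht => by
    nlinarith [ht.1, ht.2, sq_nonneg c, sq_nonneg t]
  rw [← setIntegral_rpow_mul_one_sub_rpow ha hb, setIntegral_eq_of_bijOn
    (φ' := fun t => (1 - c ^ 2) * (2 * t) / (1 - c ^ 2 * t ^ 2) ^ 2) measurableSet_Ioo ?_
    (bijOn_mul_sq_div hc) (fun u => u ^ (a - 1) * (1 - u) ^ (b - 1))]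
  · refine setIntegral_congr_fun measurableSet_Ioo fun t ht => ?_
    have h := hden t ht
    have ht0 := ht.1
    have ht2 : 0 < 1 - t ^ 2 := by nlinarith [ht.1, ht.2]
    have e : 1 - (1 - c ^ 2) * t ^ 2 / (1 - c ^ 2 * t ^ 2) =
        (1 - t ^ 2) / (1 - c ^ 2 * t ^ 2) := by
      field_simp
      ring
    simp only [e]
    rw [abs_of_pos (by positivity)]
    generalize 1 - c ^ 2 * t ^ 2 = d at *
    rw [div_rpow (by positivity) h.le, div_rpow ht2.le h.le, mul_rpow hc2.le (by positivity),
      ← rpow_natCast t, ← rpow_mul ht0.le]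
    have e1 : (1 - c ^ 2) ^ a = (1 - c ^ 2) * (1 - c ^ 2) ^ (a - 1) := by
      rw [rpow_sub_one hc2.ne']
      field_simp
    have e2 : t ^ (2 * a - 1) = t * t ^ (((2 : ℕ) : ℝ) * (a - 1)) := by
      rw [show 2 * a - 1 = 1 + ((2 : ℕ) : ℝ) * (a - 1) by push_cast; ring, rpow_add ht0, rpow_one]
    have e3 : d ^ (-a - b) = (d ^ 2 * d ^ (a - 1) * d ^ (b - 1))⁻¹ := by
      rw [← rpow_natCast d, ← rpow_add h, ← rpow_add h, ← rpow_neg h.le]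
      push_cast; ring_nf
    rw [e1, e2, e3]
    field_simp
  · intro t ht
    have h := hden t ht
    have := ((hasDerivAt_pow 2 t).const_mul (1 - c ^ 2)).div
      (((hasDerivAt_pow 2 t).const_mul (c ^ 2)).const_sub 1) h.ne'
    refine this.congr_deriv ?_
    norm_num
    ring

lemma setIntegral_Ioo_neg_one_one_eq {f : ℝ → ℝ} (hf : IntegrableOn f (Set.Ioo (-1) 1)) :
    ∫ t in Set.Ioo (-1 : ℝ) 1, f t = ∫ t in Set.Ioo (0 : ℝ) 1, (f t + f (-t)) := by
  have hi : IntervalIntegrable f volume (-1) 1 :=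
    (intervalIntegrable_iff_integrableOn_Ioo_of_le (by norm_num)).mpr hf
  have h1 : IntervalIntegrable f volume (-1) 0 := hi.mono_set (by
    rw [Set.uIcc_of_le (by norm_num), Set.uIcc_of_le (by norm_num)]
    exact Set.Icc_subset_Icc_right zero_le_one)
  have h2 : IntervalIntegrable f volume 0 1 := hi.mono_set (by
    rw [Set.uIcc_of_le (by norm_num), Set.uIcc_of_le (by norm_num)]
    exact Set.Icc_subset_Icc_left (by norm_num))
  have h3 : IntervalIntegrable (fun t => f (-t)) volume 0 1 := by
    simpa using (IntervalIntegrable.comp_sub_left h1 0).symm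
  rw [← integral_Ioc_eq_integral_Ioo, ← integral_Ioc_eq_integral_Ioo,
    ← intervalIntegral.integral_of_le (by norm_num), ← intervalIntegral.integral_of_le (by norm_num),
    intervalIntegral.integral_add h2 h3, intervalIntegral.integral_comp_neg, add_comm,
    neg_zero, intervalIntegral.integral_add_adjacent_intervals h1 h2]

lemma setIntegral_one_sub_sq_rpow {b : ℝ} (hb : 0 < b) (hb1 : b ≤ 1) :
    ∫ t in Set.Ioo (-1 : ℝ) 1, (1 - t ^ 2) ^ (b - 1) = √π * Gamma b / Gamma (1 / 2 + b) := by
  rw [setIntegral_Ioo_neg_one_one_eq (integrableOn_one_sub_sq_rpow (by linarith) (by linarith)),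
    ← Gamma_one_half_eq, ← setIntegral_rpow_mul_one_sub_sq_rpow_mul (c := 0) (by norm_num)
    (by norm_num) hb]
  refine setIntegral_congr_fun measurableSet_Ioo fun t ht => ?_
  norm_num
  ring

lemma setIntegral_abs_sub_rpow_of_abs_lt_one {s x : ℝ} (hs0 : 0 < s) (hs1 : s < 1) (hx : |x| < 1) :
    ∫ y in Set.Ioo (-1 : ℝ) 1, |x - y| ^ s * (1 - y ^ 2) ^ (-(s + 1) / 2) =
      Gamma ((s + 1) / 2) * Gamma ((1 - s) / 2) := by
  have hx2 : 0 < 1 - x ^ 2 := by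
    have := (sq_lt_one_iff_abs_lt_one x).mpr hx
    linarith
  have key : ∀ t ∈ Set.Ioo (-1 : ℝ) 1,
      (1 - x ^ 2) ^ (-(s + 1) / 2 + 1) * (1 + x * t) ^ (-2 * (-(s + 1) / 2) - 2) *
        |x - (x + t) / (1 + x * t)| ^ s * (1 - t ^ 2) ^ (-(s + 1) / 2) =
      (1 - x ^ 2) ^ ((s + 1) / 2) * |t| ^ s * (1 + x * t)⁻¹ * (1 - t ^ 2) ^ (-(s + 1) / 2) := by
    intro t ht
    have h := one_add_mul_pos hx ht
    have e : x - (x + t) / (1 + x * t) = -((1 - x ^ 2) * t / (1 + x * t)) := by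
      field_simp
      ring
    rw [e, abs_neg, abs_div, abs_mul, abs_of_pos h, abs_of_pos hx2, div_rpow (by positivity) h.le,
      mul_rpow hx2.le (abs_nonneg t), show (s + 1) / 2 = -(s + 1) / 2 + 1 + s by ring,
      rpow_add hx2 (-(s + 1) / 2 + 1) s, show -2 * (-(s + 1) / 2) - 2 = s - 1 by ring,
      rpow_sub_one h.ne']
    have : 0 < (1 + x * t) ^ s := by positivity
    field_simp
  rw [setIntegral_mul_one_sub_sq_rpow_moebius hx _ (fun y => |x - y| ^ s),
    setIntegral_congr_fun measurableSet_Ioo key, setIntegral_Ioo_neg_one_one_eq]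
  · have hG := setIntegral_rpow_mul_one_sub_sq_rpow_mul hx (a := (s + 1) / 2) (b := (1 - s) / 2)
      (by linarith) (by linarith)
    rw [show (s + 1) / 2 + (1 - s) / 2 = 1 by ring, Gamma_one, div_one] at hG
    rw [← hG]
    refine setIntegral_congr_fun measurableSet_Ioo fun t ht => ?_
    have ht' : t ∈ Set.Ioo (-1 : ℝ) 1 := ⟨by linarith [ht.1], ht.2⟩
    have h1 := one_add_mul_pos hx ht'
    have h2 := one_add_mul_pos hx (t := -t) ⟨by linarith [ht.2], by linarith [ht.1]⟩
    have e : 1 - x ^ 2 * t ^ 2 = (1 + x * t) * (1 + x * -t) := by ring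
    rw [abs_neg, abs_of_pos ht.1, neg_sq, show (1 - s) / 2 - 1 = -(s + 1) / 2 by ring,
      show -((s + 1) / 2) - (1 - s) / 2 = -1 by ring, rpow_neg_one, e,
      show 2 * ((s + 1) / 2) - 1 = s by ring]
    have e' : (1 + x * t)⁻¹ + (1 + x * -t)⁻¹ = 2 * ((1 + x * t) * (1 + x * -t))⁻¹ := by
      rw [inv_add_inv h1.ne' h2.ne']
      ring
    linear_combination (1 - x ^ 2) ^ ((s + 1) / 2) * t ^ s * (1 - t ^ 2) ^ (-(s + 1) / 2) * e'
  · refine Integrable.mono' ((integrableOn_one_sub_sq_rpow (p := -(s + 1) / 2) (by linarith)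
      (by linarith)).const_mul ((1 - x ^ 2) ^ ((s + 1) / 2) * (1 - |x|)⁻¹))
      (Measurable.aestronglyMeasurable (by fun_prop)) ?_
    refine (ae_restrict_mem measurableSet_Ioo).mono fun t ht => ?_
    have h := one_add_mul_pos hx ht
    have ht2 : 0 < 1 - t ^ 2 := by nlinarith [ht.1, ht.2]
    have htle : |t| ≤ 1 := (abs_lt.mpr ht).le
    have h3 : 1 - |x| ≤ 1 + x * t := by
      have := neg_abs_le (x * t)
      rw [abs_mul] at this
      nlinarith [abs_nonneg x]
    have h4 : (1 + x * t)⁻¹ ≤ (1 - |x|)⁻¹ := inv_anti₀ (by linarith) h3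
    have h5 : |t| ^ s ≤ 1 := rpow_le_one (abs_nonneg t) htle hs0.le
    rw [norm_of_nonneg (by positivity)]
    gcongr
    calc (1 - x ^ 2) ^ ((s + 1) / 2) * |t| ^ s ≤ (1 - x ^ 2) ^ ((s + 1) / 2) * 1 := by gcongr
      _ = _ := mul_one _

lemma setIntegral_one_sub_rpow_mul {s : ℝ} (hs0 : 0 < s) (hs1 : s < 1) :
    ∫ y in Set.Ioo (-1 : ℝ) 1, (1 - y) ^ s * (1 - y ^ 2) ^ (-(s + 1) / 2) =
      Gamma ((s + 1) / 2) * Gamma ((1 - s) / 2) := by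
  have hG := setIntegral_rpow_mul_one_sub_rpow (a := (s + 1) / 2) (b := (1 - s) / 2)
      (by linarith) (by linarith)
  rw [show (s + 1) / 2 + (1 - s) / 2 = 1 by ring, Gamma_one, div_one] at hG
  have hb : Set.BijOn (fun u : ℝ => 1 - 2 * u) (Set.Ioo 0 1) (Set.Ioo (-1) 1) := by
    refine Set.InvOn.bijOn (f' := fun y : ℝ => (1 - y) / 2)
      ⟨fun t ht => by ring, fun u hu => by ring⟩ (fun t ht => ?_) (fun u hu => ?_)
    · constructor <;> linarith [ht.1, ht.2]
    · constructor <;> linarith [hu.1, hu.2]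
  rw [← hG, setIntegral_eq_of_bijOn (φ' := fun _ => -2) measurableSet_Ioo ?_ hb]
  · refine setIntegral_congr_fun measurableSet_Ioo fun u hu => ?_
    have hu0 := hu.1
    have hu1 : 0 < 1 - u := by linarith [hu.2]
    rw [show 1 - (1 - 2 * u) = 2 * u by ring, show 1 - (1 - 2 * u) ^ 2 = 2 ^ 2 * u * (1 - u) by ring,
      mul_rpow (by positivity) hu1.le, mul_rpow (by positivity) hu0.le,
      mul_rpow (by positivity) hu0.le, show (1 - s) / 2 - 1 = -(s + 1) / 2 by ring,
      show (s + 1) / 2 - 1 = s + -(s + 1) / 2 by ring, rpow_add hu0,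
      ← rpow_natCast 2, ← rpow_mul (by norm_num),
      show ((2 : ℕ) : ℝ) * (-(s + 1) / 2) = -s - 1 by push_cast; ring,
      rpow_sub_one (by norm_num), rpow_neg (by norm_num), abs_neg, abs_two]
    field_simp
  · intro u _
    simpa using ((hasDerivAt_id u).const_mul 2).const_sub 1

lemma setIntegral_sub_rpow_sub_one_mul {s x : ℝ} (hs0 : 0 < s) (hs1 : s < 1) (hx : 1 < x) :
    ∫ y in Set.Ioo (-1 : ℝ) 1, (x - y) ^ (s - 1) * (1 - y ^ 2) ^ (-(s + 1) / 2) =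
      √π * Gamma ((1 - s) / 2) / Gamma ((2 - s) / 2) * (x ^ 2 - 1) ^ ((s - 1) / 2) := by
  have hx0 : 0 < x := by linarith
  have hc : |x⁻¹| < 1 := by
    rw [abs_of_pos (by positivity)]
    exact inv_lt_one_of_one_lt₀ hx
  have hx2 : 0 < x ^ 2 - 1 := by nlinarith
  have hI := setIntegral_one_sub_sq_rpow (b := (1 - s) / 2) (by linarith) (by linarith)
  rw [show 1 / 2 + (1 - s) / 2 = (2 - s) / 2 by ring,
    show (1 - s) / 2 - 1 = -(s + 1) / 2 by ring] at hI
  rw [setIntegral_mul_one_sub_sq_rpow_moebius hc _ (fun y => (x - y) ^ (s - 1)), ← hI,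
    ← integral_mul_const]
  refine setIntegral_congr_fun measurableSet_Ioo fun t ht => ?_
  have h := one_add_mul_pos hc ht
  have e : x - (x⁻¹ + t) / (1 + x⁻¹ * t) = (x ^ 2 - 1) / x / (1 + x⁻¹ * t) := by
    rw [eq_div_iff h.ne', sub_mul, div_mul_cancel₀ _ h.ne']
    field_simp
    ring
  have e2 : 1 - x⁻¹ ^ 2 = (x ^ 2 - 1) / x ^ 2 := by field_simp
  rw [e, e2, div_rpow (by positivity) h.le, div_rpow hx2.le (by positivity),
    div_rpow hx2.le (by positivity), show -2 * (-(s + 1) / 2) - 2 = s - 1 by ring,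
    ← rpow_natCast x, ← rpow_mul hx0.le,
    show ((2 : ℕ) : ℝ) * (-(s + 1) / 2 + 1) = -(s - 1) by push_cast; ring, rpow_neg hx0.le,
    show (s - 1) / 2 = (-(s + 1) / 2 + 1) + (s - 1) by ring, rpow_natCast, rpow_add hx2 _ (s - 1)]
  have : 0 < (1 + x⁻¹ * t) ^ (s - 1) := by positivity
  generalize (1 + x⁻¹ * t) ^ (s - 1) = D at *
  generalize (x ^ 2 - 1) ^ (-(s + 1) / 2 + 1) = E
  field_simp

lemma integral_mul_sub_rpow_sub_one {s x y : ℝ} (hs0 : 0 < s) :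
    ∫ u in (1 : ℝ)..x, s * (u - y) ^ (s - 1) = (x - y) ^ s - (1 - y) ^ s := by
  rw [intervalIntegral.integral_const_mul,
    intervalIntegral.integral_comp_sub_right (fun u => u ^ (s - 1)),
    integral_rpow (Or.inl (by linarith)), sub_add_cancel]
  field_simp

lemma integrableOn_sub_rpow_mul {s x : ℝ} (hs0 : 0 < s) (hs1 : s < 1) (hx : 1 ≤ x) :
    IntegrableOn (fun y : ℝ => (x - y) ^ s * (1 - y ^ 2) ^ (-(s + 1) / 2)) (Set.Ioo (-1) 1) := by
  refine Integrable.mono' ((integrableOn_one_sub_sq_rpow (p := -(s + 1) / 2) (by linarith)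
      (by linarith)).const_mul ((x + 1) ^ s)) (Measurable.aestronglyMeasurable (by fun_prop)) ?_
  refine (ae_restrict_mem measurableSet_Ioo).mono fun t ht => ?_
  have ht2 : 0 < 1 - t ^ 2 := by nlinarith [ht.1, ht.2]
  have ht1 : 0 < x - t := by linarith [ht.2]
  rw [norm_of_nonneg (by positivity)]
  gcongr
  linarith [ht.1]

lemma setIntegral_sub_rpow_mul {s x : ℝ} (hs0 : 0 < s) (hs1 : s < 1) (hx : 1 < x) :
    ∫ y in Set.Ioo (-1 : ℝ) 1, (x - y) ^ s * (1 - y ^ 2) ^ (-(s + 1) / 2) =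
      Gamma ((s + 1) / 2) * Gamma ((1 - s) / 2) +
        s * (√π * Gamma ((1 - s) / 2) / Gamma ((2 - s) / 2)) *
          ∫ u in (1 : ℝ)..x, (u ^ 2 - 1) ^ ((s - 1) / 2) := by
  have hw : ∀ y : ℝ, ∫ u in Set.Ioc 1 x, s * (u - y) ^ (s - 1) * (1 - y ^ 2) ^ (-(s + 1) / 2) =
      (x - y) ^ s * (1 - y ^ 2) ^ (-(s + 1) / 2) - (1 - y) ^ s * (1 - y ^ 2) ^ (-(s + 1) / 2) := by
    intro y
    rw [integral_mul_const, ← intervalIntegral.integral_of_le hx.le,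
      integral_mul_sub_rpow_sub_one hs0, sub_mul]
  have hdiff := (integrableOn_sub_rpow_mul hs0 hs1 hx.le).sub
    (integrableOn_sub_rpow_mul hs0 hs1 le_rfl)
  have hprod : Integrable (Function.uncurry fun y u : ℝ =>
      s * (u - y) ^ (s - 1) * (1 - y ^ 2) ^ (-(s + 1) / 2))
      ((volume.restrict (Set.Ioo (-1) 1)).prod (volume.restrict (Set.Ioc 1 x))) := by
    rw [integrable_prod_iff (Measurable.aestronglyMeasurable (by fun_prop))]
    constructor
    · refine .of_forall fun y => ?_
      have := (intervalIntegral.intervalIntegrable_rpow' (r := s - 1) (a := 1 - y) (b := x - y)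
        (by linarith)).comp_sub_right y
      rw [sub_add_cancel, sub_add_cancel, intervalIntegrable_iff_integrableOn_Ioc_of_le hx.le]
        at this
      exact (Integrable.const_mul this s).mul_const ((1 - y ^ 2) ^ (-(s + 1) / 2))
    · refine hdiff.congr ?_
      refine (ae_restrict_mem measurableSet_Ioo).mono fun y hy => ?_
      rw [Pi.sub_apply, ← hw]
      refine setIntegral_congr_fun measurableSet_Ioc fun u hu => ?_
      have h1 : 0 < u - y := by linarith [hy.2, hu.1]
      have h2 : 0 < 1 - y ^ 2 := by nlinarith [hy.1, hy.2]
      exact (norm_of_nonneg (by positivity)).symm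
  have hswap := integral_integral_swap hprod
  simp only [hw] at hswap
  rw [integral_sub (integrableOn_sub_rpow_mul hs0 hs1 hx.le)
    (integrableOn_sub_rpow_mul hs0 hs1 le_rfl), setIntegral_one_sub_rpow_mul hs0 hs1,
    sub_eq_iff_eq_add'] at hswap
  rw [hswap, intervalIntegral.integral_of_le hx.le, ← integral_const_mul]
  congr 1
  refine setIntegral_congr_fun measurableSet_Ioc fun u hu => ?_
  simp only [mul_assoc]
  rw [integral_const_mul, setIntegral_sub_rpow_sub_one_mul hs0 hs1 hu.1]

/-- equation (2.5). For `2 < α < 3` and `x ∈ ℝ` with `|x| ≠ 1`,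
`∫_{-1}^{1} |x-y|^{α-2} (1-y²)^{-(α-1)/2} dy` equals `c_α` if `|x| < 1` and equals
`c_α + (α-2) C_α ∫_1^{|x|} (y²-1)^{-(3-α)/2} dy` if `|x| > 1`. -/
theorem integral_abs_rpow_sub_two
    (α : ℝ) (hα2 : 2 < α) (hα3 : α < 3)
    (Cα cα : ℝ)
    (hC : Cα = Real.sqrt π * Real.Gamma ((3 - α) / 2) / Real.Gamma ((4 - α) / 2))
    (hc : cα = π / Real.sin ((α - 1) * π / 2)) :
    ∀ x : ℝ, |x| ≠ 1 →
      (∫ y in (-1 : ℝ)..1, |x - y| ^ (α - 2) * (1 - y ^ 2) ^ (-(α - 1) / 2)) =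
        if |x| < 1 then cα
        else cα + (α - 2) * Cα * ∫ y in (1 : ℝ)..|x|, (y ^ 2 - 1) ^ (-(3 - α) / 2) := by
  intro x hx
  obtain ⟨s, rfl⟩ : ∃ s, α = s + 2 := ⟨α - 2, by ring⟩
  have hs0 : 0 < s := by linarith
  have hs1 : s < 1 := by linarith
  have hcα : cα = Gamma ((s + 1) / 2) * Gamma ((1 - s) / 2) := by
    have := Gamma_mul_Gamma_one_sub ((s + 1) / 2)
    rw [show 1 - (s + 1) / 2 = (1 - s) / 2 by ring] at this
    rw [hc, this]
    ring_nf
  rw [show s + 2 - 2 = s by ring, show -(s + 2 - 1) / 2 = -(s + 1) / 2 by ring,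
    show -(3 - (s + 2)) / 2 = (s - 1) / 2 by ring]
  rw [show (3 - (s + 2)) / 2 = (1 - s) / 2 by ring, show (4 - (s + 2)) / 2 = (2 - s) / 2 by ring]
    at hC
  have habs : (∫ y in (-1 : ℝ)..1, |x - y| ^ s * (1 - y ^ 2) ^ (-(s + 1) / 2)) =
      ∫ y in Set.Ioo (-1 : ℝ) 1, |(|x|) - y| ^ s * (1 - y ^ 2) ^ (-(s + 1) / 2) := by
    rw [← integral_Ioc_eq_integral_Ioo, ← intervalIntegral.integral_of_le (by norm_num)]
    rcases abs_choice x with h | h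
    · rw [h]
    · have := intervalIntegral.integral_comp_neg (a := -1) (b := 1)
        (fun y : ℝ => |x - y| ^ s * (1 - y ^ 2) ^ (-(s + 1) / 2))
      rw [neg_neg] at this
      rw [h, ← this]
      refine intervalIntegral.integral_congr fun y _ => ?_
      rw [neg_sq, ← abs_neg (x - -y)]
      congr 3
      ring
  rw [habs, hcα, hC]
  split_ifs with h
  · exact setIntegral_abs_sub_rpow_of_abs_lt_one hs0 hs1 (by rwa [abs_abs])
  · have hx1 : 1 < |x| := lt_of_le_of_ne (not_lt.mp h) (Ne.symm hx)
    rw [← setIntegral_sub_rpow_mul hs0 hs1 hx1]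
    refine setIntegral_congr_fun measurableSet_Ioo fun y hy => ?_
    rw [abs_of_pos (by linarith [hy.2])]
end

section
/- Let 1 < α < 2. Then for every x ∈ ℝ with |x| ≠ 1, ∫_{−1}^{1} |x−y|^{α−2} (1−y²)^{−(α−1)/2} dy = c_α if |x| < 1, and = c_α + c_α^{(1)} − (α−2) C_α ∫_{|x|}^{∞} (y²−1)^{−(3−α)/2} dy if |x| > 1, where c_α = π / sin((α−1)π/2), C_α = √π Γ((3-α)/2)/Γ((4-α)/2), and c_α^{(1)} = −C_α Γ((α−1)/2) Γ((4−α)/2)/√π. -/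
open MeasureTheory Real

open Set ProbabilityTheory

/-- Change of variables in a lower integral of a real-valued function, the substitution being
given together with its inverse. -/
theorem setLIntegral_ofReal_substitution {s t : Set ℝ} (hs : MeasurableSet s)
    {φ ψ φ' f g : ℝ → ℝ} (hφ : MapsTo φ s t) (hψ : MapsTo ψ t s)
    (hl : LeftInvOn ψ φ s) (hr : RightInvOn ψ φ t)
    (hd : ∀ u ∈ s, HasDerivAt φ (φ' u) u) (h : ∀ u ∈ s, |φ' u| * f (φ u) = g u) :
    ∫⁻ v in t, ENNReal.ofReal (f v) = ∫⁻ u in s, ENNReal.ofReal (g u) := by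
  have him : φ '' s = t := (InvOn.bijOn ⟨hl, hr⟩ hφ hψ).image_eq
  rw [← him, lintegral_image_eq_lintegral_abs_deriv_mul hs
    (fun u hu => (hd u hu).hasDerivWithinAt) hl.injOn]
  refine setLIntegral_congr_fun hs fun u hu => ?_
  rw [← h u hu, ENNReal.ofReal_mul (abs_nonneg _)]

theorem lintegral_rpow_mul_one_sub_rpow {p q : ℝ} (hp : 0 < p) (hq : 0 < q) :
    ∫⁻ u in Ioo (0 : ℝ) 1, ENNReal.ofReal (u ^ (p - 1) * (1 - u) ^ (q - 1)) =
      ENNReal.ofReal (beta p q) := by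
  have h := lintegral_betaPDF_eq_one hp hq
  have hb := beta_pos hp hq
  simp_rw [lintegral_betaPDF, mul_assoc, ENNReal.ofReal_mul (one_div_pos.2 hb).le] at h
  rw [lintegral_const_mul _ (by fun_prop)] at h
  calc
    _ = ENNReal.ofReal (beta p q) * (ENNReal.ofReal (1 / beta p q) *
          ∫⁻ u in Ioo (0 : ℝ) 1, ENNReal.ofReal (u ^ (p - 1) * (1 - u) ^ (q - 1))) := by
      rw [← mul_assoc, ← ENNReal.ofReal_mul hb.le, mul_one_div_cancel hb.ne',
        ENNReal.ofReal_one, one_mul]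
    _ = _ := by rw [h, mul_one]

/-- Splitting a lower integral over `(-1, 1)` at the origin. -/
theorem lintegral_Ioo_neg_one_one_eq {f : ℝ → ℝ} (hf : Measurable f)
    (h0 : ∀ t ∈ Ioo (-1 : ℝ) 1, 0 ≤ f t) :
    ∫⁻ t in Ioo (-1 : ℝ) 1, ENNReal.ofReal (f t) =
      ∫⁻ t in Ioo (0 : ℝ) 1, ENNReal.ofReal (f t + f (-t)) := by
  have hu : Ioc (-1 : ℝ) 0 ∪ Ioo 0 1 = Ioo (-1) 1 :=
    Ioc_union_Ioo_eq_Ioo (by norm_num) (by norm_num)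
  have hdisj : Disjoint (Ioc (-1 : ℝ) 0) (Ioo 0 1) :=
    Set.disjoint_left.2 fun t h1 h2 => absurd h1.2 (not_le.2 h2.1)
  have hneg : ∫⁻ t in Ioo (-1 : ℝ) 0, ENNReal.ofReal (f t) =
      ∫⁻ t in Ioo (0 : ℝ) 1, ENNReal.ofReal (f (-t)) :=
    setLIntegral_ofReal_substitution (φ := fun t => -t) (ψ := fun t => -t) (φ' := fun _ => -1)
      measurableSet_Ioo
      (fun t ht => ⟨by linarith [ht.2], by linarith [ht.1]⟩)
      (fun t ht => ⟨by linarith [ht.2], by linarith [ht.1]⟩)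
      (fun t _ => neg_neg t) (fun t _ => neg_neg t)
      (fun t _ => hasDerivAt_neg t) (fun t _ => by simp)
  rw [← hu, lintegral_union measurableSet_Ioo hdisj, setLIntegral_congr Ioo_ae_eq_Ioc.symm,
    hneg, add_comm, ← lintegral_add_left (by fun_prop)]
  refine setLIntegral_congr_fun measurableSet_Ioo fun t ht => ?_
  exact (ENNReal.ofReal_add (h0 t ⟨by linarith [ht.1], ht.2⟩)
    (h0 (-t) ⟨by linarith [ht.2], by linarith [ht.1]⟩)).symm

theorem lintegral_Ioo_zero_one_comp_sq (f : ℝ → ℝ) :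
    ∫⁻ u in Ioo (0 : ℝ) 1, ENNReal.ofReal (f u) =
      ∫⁻ t in Ioo (0 : ℝ) 1, ENNReal.ofReal (2 * t * f (t ^ 2)) := by
  refine setLIntegral_ofReal_substitution (φ := fun t => t ^ 2) (ψ := fun u => √u)
    (φ' := fun t => 2 * t) measurableSet_Ioo
    (fun t ht => ⟨pow_pos ht.1 2, by nlinarith [ht.1, ht.2]⟩)
    (fun u hu => ⟨Real.sqrt_pos.2 hu.1, ?_⟩)
    (fun t ht => Real.sqrt_sq ht.1.le) (fun u hu => Real.sq_sqrt hu.1.le)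
    (fun t _ => by simpa using hasDerivAt_pow 2 t) (fun t ht => ?_)
  · rw [Real.sqrt_lt' one_pos]
    simpa using hu.2
  · rw [abs_of_pos (by linarith [ht.1])]

theorem exists_eq_exp {x : ℝ} (hx : 0 < x) : ∃ y, x = Real.exp y :=
  ⟨Real.log x, (Real.exp_log hx).symm⟩

/-- An instance of Euler's integral for `₂F₁(1, b; 1; z) = (1 - z) ^ (-b)`. -/
theorem lintegral_rpow_div_one_sub_mul {b z : ℝ} (hb0 : 0 < b) (hb1 : b < 1)
    (hz0 : 0 ≤ z) (hz1 : z < 1) :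
    ∫⁻ u in Ioo (0 : ℝ) 1, ENNReal.ofReal
        ((1 - z) ^ b * (u ^ (b - 1) * (1 - u) ^ (-b) / (1 - z * u))) =
      ENNReal.ofReal (beta b (1 - b)) := by
  rw [← lintegral_rpow_mul_one_sub_rpow hb0 (sub_pos.2 hb1)]
  have hw : 0 < 1 - z := sub_pos.2 hz1
  have hD : ∀ u ∈ Ioo (0 : ℝ) 1, 0 < 1 - z * u := fun u hu => by
    nlinarith [hu.1, hu.2]
  have hE : ∀ v ∈ Ioo (0 : ℝ) 1, 0 < 1 - z + z * v := fun v hv => by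
    nlinarith [hv.1, hv.2, mul_nonneg hz0 hv.1.le]
  symm
  refine setLIntegral_ofReal_substitution (φ := fun u => u * (1 - z) / (1 - z * u))
    (ψ := fun v => v / (1 - z + z * v)) (φ' := fun u => (1 - z) / (1 - z * u) ^ 2)
    measurableSet_Ioo
    (fun u hu => ⟨div_pos (mul_pos hu.1 hw) (hD u hu), ?_⟩)
    (fun v hv => ⟨div_pos hv.1 (hE v hv), ?_⟩)
    (fun u hu => ?_) (fun v hv => ?_) (fun u hu => ?_) (fun u hu => ?_)
  · rw [div_lt_one (hD u hu)]
    linarith [hu.2]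
  · rw [div_lt_one (hE v hv)]
    nlinarith [hv.2]
  · have := (hD u hu).ne'
    have h3 : 1 - u * z ≠ 0 := by rwa [mul_comm u]
    have h2 : 1 - z + z * (u * (1 - z) / (1 - z * u)) = (1 - z) / (1 - z * u) := by
      field_simp
      ring
    simp only [h2]
    field_simp
  · have := (hE v hv).ne'
    have h3 : 1 - z + v * z ≠ 0 := by rwa [mul_comm v]
    have h2 : 1 - z * (v / (1 - z + z * v)) = (1 - z) / (1 - z + z * v) := by
      field_simp
      ring
    simp only [h2]
    field_simp
  · have := (hD u hu).ne'
    refine (((hasDerivAt_id u).mul_const (1 - z)).div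
      (((hasDerivAt_id u).const_mul z).const_sub 1) this).congr_deriv ?_
    simp only [id]
    field_simp
    ring
  · have hDu := hD u hu
    have h3 : 1 - u * z ≠ 0 := by rw [mul_comm]; exact hDu.ne'
    have h2 : 1 - u * (1 - z) / (1 - z * u) = (1 - u) / (1 - z * u) := by
      field_simp
      ring
    simp only [h2]
    rw [abs_of_pos (by positivity)]
    obtain ⟨d, hd⟩ := exists_eq_exp hDu
    obtain ⟨w, hw⟩ := exists_eq_exp hw
    obtain ⟨m, hm⟩ := exists_eq_exp (sub_pos.2 hu.2)
    obtain ⟨l, hl⟩ := exists_eq_exp hu.1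
    rw [hd, hw, hm, hl]
    simp only [← Real.exp_nat_mul, ← Real.exp_add, ← Real.exp_sub, ← Real.exp_mul]
    congr 1
    push_cast
    ring

/-- The case of a singularity inside the interval. -/
theorem lintegral_abs_sub_rpow_of_abs_lt_one {a x : ℝ} (ha0 : 0 < a) (ha1 : a < 1)
    (hx : |x| < 1) :
    ∫⁻ y in Ioo (-1 : ℝ) 1, ENNReal.ofReal (|x - y| ^ (a - 1) * (1 - y ^ 2) ^ (-(a / 2))) =
      ENNReal.ofReal (beta (a / 2) (1 - a / 2)) := by
  obtain ⟨hx1, hx2⟩ := abs_lt.1 hx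
  have hw : 0 < 1 - x ^ 2 := by nlinarith
  have hm : ∀ t ∈ Ioo (-1 : ℝ) 1, 0 < 1 - t ^ 2 := fun t ht => by nlinarith [ht.1, ht.2]
  have hD : ∀ t ∈ Ioo (-1 : ℝ) 1, 0 < 1 + x * t := fun t ht => by
    nlinarith [mul_pos (sub_pos.2 hx2) (sub_pos.2 ht.2),
      mul_pos (neg_lt_iff_pos_add.1 hx1) (neg_lt_iff_pos_add.1 ht.1)]
  have hE : ∀ y ∈ Ioo (-1 : ℝ) 1, 0 < 1 - x * y := fun y hy => by
    have := hD (-y) ⟨by linarith [hy.2], by linarith [hy.1]⟩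
    linarith
  have hmob : ∫⁻ y in Ioo (-1 : ℝ) 1,
        ENNReal.ofReal (|x - y| ^ (a - 1) * (1 - y ^ 2) ^ (-(a / 2))) =
      ∫⁻ t in Ioo (-1 : ℝ) 1, ENNReal.ofReal
        ((1 - x ^ 2) ^ (a / 2) * |t| ^ (a - 1) * (1 - t ^ 2) ^ (-(a / 2)) / (1 + x * t)) := by
    refine setLIntegral_ofReal_substitution (φ := fun t => (t + x) / (1 + x * t))
      (ψ := fun y => (y - x) / (1 - x * y)) (φ' := fun t => (1 - x ^ 2) / (1 + x * t) ^ 2)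
      measurableSet_Ioo (fun t ht => ⟨?_, ?_⟩) (fun y hy => ⟨?_, ?_⟩)
      (fun t ht => ?_) (fun y hy => ?_) (fun t ht => ?_) (fun t ht => ?_)
    · rw [lt_div_iff₀ (hD t ht)]
      nlinarith [mul_pos (neg_lt_iff_pos_add.1 hx1) (neg_lt_iff_pos_add.1 ht.1)]
    · rw [div_lt_one (hD t ht)]
      nlinarith [mul_pos (sub_pos.2 hx2) (sub_pos.2 ht.2)]
    · rw [lt_div_iff₀ (hE y hy)]
      nlinarith [mul_pos (sub_pos.2 hx2) (neg_lt_iff_pos_add.1 hy.1)]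
    · rw [div_lt_one (hE y hy)]
      nlinarith [mul_pos (neg_lt_iff_pos_add.1 hx1) (sub_pos.2 hy.2)]
    · have := (hD t ht).ne'
      have h3 : 1 + t * x ≠ 0 := by rwa [mul_comm t]
      have h2 : 1 - x * ((t + x) / (1 + x * t)) = (1 - x ^ 2) / (1 + x * t) := by
        field_simp
        ring
      simp only [h2]
      field_simp
      ring
    · have := (hE y hy).ne'
      have h3 : 1 - y * x ≠ 0 := by rwa [mul_comm y]
      have h2 : 1 + x * ((y - x) / (1 - x * y)) = (1 - x ^ 2) / (1 - x * y) := by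
        field_simp
        ring
      simp only [h2]
      field_simp
      ring
    · have := (hD t ht).ne'
      refine (((hasDerivAt_id t).add_const x).div
        (((hasDerivAt_id t).const_mul x).const_add 1) this).congr_deriv ?_
      simp only [id]
      field_simp
      ring
    · have hDt := hD t ht
      have h3 : 1 + t * x ≠ 0 := by rw [mul_comm]; exact hDt.ne'
      have h1 : |x - (t + x) / (1 + x * t)| = |t| * ((1 - x ^ 2) / (1 + x * t)) := by
        have : x - (t + x) / (1 + x * t) = -(t * ((1 - x ^ 2) / (1 + x * t))) := by
          field_simp
          ring
        rw [this, abs_neg, abs_mul, abs_of_pos (div_pos hw hDt)]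
      have h2 : 1 - ((t + x) / (1 + x * t)) ^ 2 =
          (1 - x ^ 2) * (1 - t ^ 2) / (1 + x * t) ^ 2 := by
        field_simp
        ring
      simp only [h1, h2]
      rw [abs_of_pos (by positivity), Real.mul_rpow (abs_nonneg t) (div_pos hw hDt).le]
      have key : (1 - x ^ 2) / (1 + x * t) ^ 2 * (((1 - x ^ 2) / (1 + x * t)) ^ (a - 1) *
          ((1 - x ^ 2) * (1 - t ^ 2) / (1 + x * t) ^ 2) ^ (-(a / 2))) =
          (1 - x ^ 2) ^ (a / 2) * (1 - t ^ 2) ^ (-(a / 2)) / (1 + x * t) := by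
        obtain ⟨d, hd⟩ := exists_eq_exp hDt
        obtain ⟨w, hw⟩ := exists_eq_exp hw
        obtain ⟨m, hm⟩ := exists_eq_exp (hm t ht)
        rw [hd, hw, hm]
        simp only [← Real.exp_nat_mul, ← Real.exp_add, ← Real.exp_sub, ← Real.exp_mul]
        congr 1
        push_cast
        ring
      linear_combination |t| ^ (a - 1) * key
  rw [hmob, lintegral_Ioo_neg_one_one_eq (by fun_prop) fun t ht => by
      have := hD t ht
      have := hm t ht
      positivity,
    ← lintegral_rpow_div_one_sub_mul (z := x ^ 2) (half_pos ha0) (by linarith) (sq_nonneg x)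
      (by linarith),
    lintegral_Ioo_zero_one_comp_sq fun u =>
      (1 - x ^ 2) ^ (a / 2) * (u ^ (a / 2 - 1) * (1 - u) ^ (-(a / 2)) / (1 - x ^ 2 * u))]
  refine setLIntegral_congr_fun measurableSet_Ioo fun t ht => ?_
  have ht' : t ∈ Ioo (-1 : ℝ) 1 := ⟨by linarith [ht.1], ht.2⟩
  have h1 := (hD t ht').ne'
  have h2 := (hE t ht').ne'
  have h3 : 1 - x ^ 2 * t ^ 2 = (1 + x * t) * (1 - x * t) := by ring
  have h4 : t * (t ^ 2) ^ (a / 2 - 1) = t ^ (a - 1) := by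
    obtain ⟨l, hl⟩ := exists_eq_exp ht.1
    rw [hl]
    simp only [← Real.exp_nat_mul, ← Real.exp_add, ← Real.exp_mul]
    congr 1
    push_cast
    ring
  rw [h3, abs_neg, abs_of_pos ht.1, ← h4, neg_sq, mul_neg, ← sub_eq_add_neg]
  congr 1
  field_simp
  ring

theorem lintegral_one_sub_sq_rpow {a : ℝ} (ha : a < 1) :
    ∫⁻ t in Ioo (-1 : ℝ) 1, ENNReal.ofReal ((1 - t ^ 2) ^ (-(a / 2))) =
      ENNReal.ofReal (beta (1 / 2) (1 - a / 2)) := by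
  have hm : ∀ t ∈ Ioo (-1 : ℝ) 1, 0 < 1 - t ^ 2 := fun t ht => by nlinarith [ht.1, ht.2]
  rw [lintegral_Ioo_neg_one_one_eq (by fun_prop) fun t ht => by
      have := hm t ht
      positivity,
    ← lintegral_rpow_mul_one_sub_rpow (by norm_num) (by linarith),
    lintegral_Ioo_zero_one_comp_sq fun u => u ^ ((1 : ℝ) / 2 - 1) * (1 - u) ^ (1 - a / 2 - 1)]
  refine setLIntegral_congr_fun measurableSet_Ioo fun t ht => ?_
  have h4 : t * (t ^ 2) ^ ((1 : ℝ) / 2 - 1) = 1 := by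
    obtain ⟨l, hl⟩ := exists_eq_exp ht.1
    rw [hl]
    simp only [← Real.exp_nat_mul, ← Real.exp_add, ← Real.exp_mul]
    rw [Real.exp_eq_one_iff]
    push_cast
    ring
  have h5 : 1 - a / 2 - 1 = -(a / 2) := by ring
  rw [h5, mul_assoc, ← mul_assoc t, h4, neg_sq]
  congr 1
  ring

/-- The kernel of exponent `a - 2` is covariant under the projective group of `(-1, 1)`. -/
theorem lintegral_sub_rpow_sub_two {a s : ℝ} (ha1 : a < 1) (hs : 1 < s) :
    ∫⁻ y in Ioo (-1 : ℝ) 1, ENNReal.ofReal ((s - y) ^ (a - 2) * (1 - y ^ 2) ^ (-(a / 2))) =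
      ENNReal.ofReal (beta (1 / 2) (1 - a / 2)) *
        ENNReal.ofReal ((s ^ 2 - 1) ^ (a / 2 - 1)) := by
  have hw : 0 < s ^ 2 - 1 := by nlinarith
  have hm : ∀ t ∈ Ioo (-1 : ℝ) 1, 0 < 1 - t ^ 2 := fun t ht => by nlinarith [ht.1, ht.2]
  have hD : ∀ t ∈ Ioo (-1 : ℝ) 1, 0 < s + t := fun t ht => by linarith [ht.1]
  have hE : ∀ y ∈ Ioo (-1 : ℝ) 1, 0 < s - y := fun y hy => by linarith [hy.2]
  rw [← lintegral_one_sub_sq_rpow ha1, ← lintegral_mul_const _ (by fun_prop)]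
  have hg : ∀ t ∈ Ioo (-1 : ℝ) 1,
      ENNReal.ofReal ((1 - t ^ 2) ^ (-(a / 2))) * ENNReal.ofReal ((s ^ 2 - 1) ^ (a / 2 - 1)) =
        ENNReal.ofReal ((1 - t ^ 2) ^ (-(a / 2)) * (s ^ 2 - 1) ^ (a / 2 - 1)) := fun t ht =>
    (ENNReal.ofReal_mul (Real.rpow_nonneg (hm t ht).le _)).symm
  rw [setLIntegral_congr_fun measurableSet_Ioo hg]
  refine setLIntegral_ofReal_substitution (φ := fun t => (s * t + 1) / (s + t))
    (ψ := fun y => (s * y - 1) / (s - y)) (φ' := fun t => (s ^ 2 - 1) / (s + t) ^ 2)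
    measurableSet_Ioo (fun t ht => ⟨?_, ?_⟩) (fun y hy => ⟨?_, ?_⟩)
    (fun t ht => ?_) (fun y hy => ?_) (fun t ht => ?_) (fun t ht => ?_)
  · rw [lt_div_iff₀ (hD t ht)]
    nlinarith [ht.1]
  · rw [div_lt_one (hD t ht)]
    nlinarith [ht.2]
  · rw [lt_div_iff₀ (hE y hy)]
    nlinarith [hy.1]
  · rw [div_lt_one (hE y hy)]
    nlinarith [hy.2]
  · have := (hD t ht).ne'
    have h2 : s - (s * t + 1) / (s + t) = (s ^ 2 - 1) / (s + t) := by
      field_simp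
      ring
    simp only [h2]
    field_simp
    ring
  · have := (hE y hy).ne'
    have h2 : s + (s * y - 1) / (s - y) = (s ^ 2 - 1) / (s - y) := by
      field_simp
      ring
    simp only [h2]
    field_simp
    ring
  · have := (hD t ht).ne'
    refine ((((hasDerivAt_id t).const_mul s).add_const 1).div
      ((hasDerivAt_id t).const_add s) this).congr_deriv ?_
    simp only [id]
    field_simp
    ring
  · have hDt := hD t ht
    have h1 : s - (s * t + 1) / (s + t) = (s ^ 2 - 1) / (s + t) := by
      field_simp
      ring
    have h2 : 1 - ((s * t + 1) / (s + t)) ^ 2 =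
        (s ^ 2 - 1) * (1 - t ^ 2) / (s + t) ^ 2 := by
      field_simp
      ring
    simp only [h1, h2]
    rw [abs_of_pos (by positivity)]
    obtain ⟨d, hd⟩ := exists_eq_exp hDt
    obtain ⟨w, hw⟩ := exists_eq_exp hw
    obtain ⟨m, hm⟩ := exists_eq_exp (hm t ht)
    rw [hd, hw, hm]
    simp only [← Real.exp_nat_mul, ← Real.exp_add, ← Real.exp_sub, ← Real.exp_mul]
    congr 1
    push_cast
    ring

theorem lintegral_Ioi_sub_rpow {p x y : ℝ} (hp : p < -1) (hxy : y < x) :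
    ∫⁻ s in Ioi x, ENNReal.ofReal ((s - y) ^ p) =
      ENNReal.ofReal ((x - y) ^ (p + 1) / -(p + 1)) := by
  have hc : 0 < x - y := sub_pos.2 hxy
  have hshift : ∫⁻ u in Ioi (x - y), ENNReal.ofReal (u ^ p) =
      ∫⁻ s in Ioi x, ENNReal.ofReal ((s - y) ^ p) :=
    setLIntegral_ofReal_substitution (φ := fun s => s - y) (ψ := fun u => u + y)
      (φ' := fun _ => 1) measurableSet_Ioi
      (fun s hs => sub_lt_sub_right (mem_Ioi.1 hs) y)
      (fun u hu => show x < u + y by linarith [mem_Ioi.1 hu])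
      (fun s _ => sub_add_cancel s y) (fun u _ => add_sub_cancel_right u y)
      (fun s _ => (hasDerivAt_id s).sub_const y) (fun s _ => by simp)
  rw [← hshift, ← ofReal_integral_eq_lintegral_ofReal (integrableOn_Ioi_rpow_of_lt hp hc),
    integral_Ioi_rpow_of_lt hp hc, div_neg, neg_div]
  exact ae_restrict_of_forall_mem measurableSet_Ioi fun u hu =>
    Real.rpow_nonneg (hc.trans hu).le _

/-- The case of a singularity outside the interval. -/
theorem lintegral_sub_rpow_of_one_lt {a x : ℝ} (ha1 : a < 1) (hx : 1 < x) :
    ∫⁻ y in Ioo (-1 : ℝ) 1, ENNReal.ofReal ((x - y) ^ (a - 1) * (1 - y ^ 2) ^ (-(a / 2))) =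
      ENNReal.ofReal ((1 - a) * beta (1 / 2) (1 - a / 2)) *
        ∫⁻ s in Ioi x, ENNReal.ofReal ((s ^ 2 - 1) ^ (a / 2 - 1)) := by
  have ha : 0 < 1 - a := sub_pos.2 ha1
  have hm : ∀ t ∈ Ioo (-1 : ℝ) 1, 0 < 1 - t ^ 2 := fun t ht => by nlinarith [ht.1, ht.2]
  calc
    _ = ∫⁻ y in Ioo (-1 : ℝ) 1, ENNReal.ofReal (1 - a) *
          ∫⁻ s in Ioi x, ENNReal.ofReal ((s - y) ^ (a - 2) * (1 - y ^ 2) ^ (-(a / 2))) := by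
      refine setLIntegral_congr_fun measurableSet_Ioo fun y hy => ?_
      have hk : ∀ s, ENNReal.ofReal ((s - y) ^ (a - 2) * (1 - y ^ 2) ^ (-(a / 2))) =
          ENNReal.ofReal ((s - y) ^ (a - 2)) * ENNReal.ofReal ((1 - y ^ 2) ^ (-(a / 2))) :=
        fun s => ENNReal.ofReal_mul' (Real.rpow_nonneg (hm y hy).le _)
      have hxy : y < x := hy.2.trans hx
      have hpos : 0 ≤ (x - y) ^ (a - 2 + 1) / -(a - 2 + 1) :=
        div_nonneg (Real.rpow_nonneg (sub_pos.2 hxy).le _) (by linarith)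
      simp only [hk]
      rw [lintegral_mul_const _ (by fun_prop), lintegral_Ioi_sub_rpow (by linarith) hxy,
        ← ENNReal.ofReal_mul hpos, ← ENNReal.ofReal_mul ha.le]
      have h1 : a - 2 + 1 = a - 1 := by ring
      have h2 : -(a - 1) = 1 - a := by ring
      rw [h1, h2]
      congr 1
      field_simp
    _ = ENNReal.ofReal (1 - a) * ∫⁻ s in Ioi x, ∫⁻ y in Ioo (-1 : ℝ) 1,
          ENNReal.ofReal ((s - y) ^ (a - 2) * (1 - y ^ 2) ^ (-(a / 2))) := by
      rw [lintegral_const_mul' _ _ ENNReal.ofReal_ne_top, lintegral_lintegral_swap]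
      exact Measurable.aemeasurable (by fun_prop)
    _ = ENNReal.ofReal (1 - a) * ∫⁻ s in Ioi x, ENNReal.ofReal (beta (1 / 2) (1 - a / 2)) *
          ENNReal.ofReal ((s ^ 2 - 1) ^ (a / 2 - 1)) := by
      congr 1
      exact setLIntegral_congr_fun measurableSet_Ioi fun s hs =>
        lintegral_sub_rpow_sub_two ha1 (hx.trans hs)
    _ = _ := by
      rw [lintegral_const_mul' _ _ ENNReal.ofReal_ne_top, ← mul_assoc,
        ← ENNReal.ofReal_mul ha.le]

theorem intervalIntegral_abs_sub_rpow_eq_toReal (a x : ℝ) :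
    ∫ y in (-1 : ℝ)..1, |x - y| ^ (a - 1) * (1 - y ^ 2) ^ (-(a / 2)) =
      (∫⁻ y in Ioo (-1 : ℝ) 1,
        ENNReal.ofReal (|x - y| ^ (a - 1) * (1 - y ^ 2) ^ (-(a / 2)))).toReal := by
  rw [intervalIntegral.integral_of_le (by norm_num), integral_Ioc_eq_integral_Ioo,
    integral_eq_lintegral_of_nonneg_ae]
  · refine ae_restrict_of_forall_mem measurableSet_Ioo fun y hy => ?_
    have : 0 < 1 - y ^ 2 := by nlinarith [hy.1, hy.2]
    simp only [Pi.zero_apply]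
    positivity
  · exact Measurable.aestronglyMeasurable (by fun_prop)

theorem integral_abs_sub_rpow_of_one_lt {a x : ℝ} (ha1 : a < 1) (hx : 1 < x) :
    ∫ y in (-1 : ℝ)..1, |x - y| ^ (a - 1) * (1 - y ^ 2) ^ (-(a / 2)) =
      (1 - a) * beta (1 / 2) (1 - a / 2) * ∫ s in Ioi x, (s ^ 2 - 1) ^ (a / 2 - 1) := by
  have hb : 0 < beta (1 / 2) (1 - a / 2) := beta_pos (by norm_num) (by linarith)
  rw [intervalIntegral_abs_sub_rpow_eq_toReal, integral_eq_lintegral_of_nonneg_ae,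
    ← ENNReal.toReal_ofReal (mul_pos (sub_pos.2 ha1) hb).le, ← ENNReal.toReal_mul,
    ← lintegral_sub_rpow_of_one_lt ha1 hx]
  · congr 1
    refine setLIntegral_congr_fun measurableSet_Ioo fun y hy => ?_
    rw [abs_of_pos (by linarith [hy.2])]
  · refine ae_restrict_of_forall_mem measurableSet_Ioi fun s hs => ?_
    have : 1 < s := hx.trans hs
    exact Real.rpow_nonneg (by nlinarith) _
  · exact Measurable.aestronglyMeasurable (by fun_prop)

theorem integral_abs_sub_rpow_neg (a x : ℝ) :
    ∫ y in (-1 : ℝ)..1, |-x - y| ^ (a - 1) * (1 - y ^ 2) ^ (-(a / 2)) =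
      ∫ y in (-1 : ℝ)..1, |x - y| ^ (a - 1) * (1 - y ^ 2) ^ (-(a / 2)) := by
  have h := intervalIntegral.integral_comp_neg (a := -1) (b := 1)
    (fun y : ℝ => |x - y| ^ (a - 1) * (1 - y ^ 2) ^ (-(a / 2)))
  rw [neg_neg] at h
  rw [← h]
  refine intervalIntegral.integral_congr fun y _ => ?_
  simp only [neg_sq]
  rw [← abs_neg (-x - y)]
  congr 3
  ring

/-- equation (3.2). For `1 < α < 2` and `x ∈ ℝ` with `|x| ≠ 1`,
`∫_{-1}^{1} |x-y|^{α-2} (1-y²)^{-(α-1)/2} dy` equals `c_α` if `|x| < 1` and equals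
`c_α + c_α⁽¹⁾ - (α-2) C_α ∫_{|x|}^∞ (y²-1)^{-(3-α)/2} dy` if `|x| > 1`, with
`c_α⁽¹⁾ = -C_α Γ((α-1)/2) Γ((4-α)/2)/√π`. -/
theorem integral_abs_rpow_sub_two_one_lt_alpha_lt_two
    (α : ℝ) (hα1 : 1 < α) (hα2 : α < 2)
    (Cα cα cα1 : ℝ)
    (hC : Cα = Real.sqrt π * Real.Gamma ((3 - α) / 2) / Real.Gamma ((4 - α) / 2))
    (hc : cα = π / Real.sin ((α - 1) * π / 2))
    (hc1 : cα1 = -Cα * (Real.Gamma ((α - 1) / 2) * Real.Gamma ((4 - α) / 2) / Real.sqrt π)) :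
    ∀ x : ℝ, |x| ≠ 1 →
      (∫ y in (-1 : ℝ)..1, |x - y| ^ (α - 2) * (1 - y ^ 2) ^ (-(α - 1) / 2)) =
        if |x| < 1 then cα
        else cα + cα1 - (α - 2) * Cα * ∫ y in Set.Ioi |x|, (y ^ 2 - 1) ^ (-(3 - α) / 2) := by
  have he1 : α - 2 = (α - 1) - 1 := by ring
  have he2 : -(α - 1) / 2 = -((α - 1) / 2) := by ring
  have he3 : -(3 - α) / 2 = (α - 1) / 2 - 1 := by ring
  have hΓ : Real.Gamma ((α - 1) / 2) * Real.Gamma ((3 - α) / 2) = cα := by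
    have h := Real.Gamma_mul_Gamma_one_sub ((α - 1) / 2)
    have h1 : 1 - (α - 1) / 2 = (3 - α) / 2 := by ring
    have h2 : π * ((α - 1) / 2) = (α - 1) * π / 2 := by ring
    rw [h1, h2] at h
    rw [h, hc]
  have hbeta : beta ((α - 1) / 2) (1 - (α - 1) / 2) = cα := by
    have h1 : 1 - (α - 1) / 2 = (3 - α) / 2 := by ring
    have h2 : (α - 1) / 2 + (3 - α) / 2 = 1 := by ring
    rw [beta, h1, h2, hΓ, Real.Gamma_one, div_one]
  have hcα : 0 < cα := hbeta ▸ beta_pos (by linarith) (by linarith)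
  have hCbeta : beta (1 / 2) (1 - (α - 1) / 2) = Cα := by
    have h1 : 1 - (α - 1) / 2 = (3 - α) / 2 := by ring
    have h2 : 1 / 2 + (3 - α) / 2 = (4 - α) / 2 := by ring
    rw [beta, h1, h2, Real.Gamma_one_half_eq, hC]
  have hsum : cα + cα1 = 0 := by
    have hG : Real.Gamma ((4 - α) / 2) ≠ 0 := (Real.Gamma_pos_of_pos (by linarith)).ne'
    have hπ : √π ≠ 0 := (Real.sqrt_pos.2 Real.pi_pos).ne'
    rw [hc1, hC, ← hΓ]
    field_simp
    ring
  intro x hx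
  rw [he2, he3, he1]
  split_ifs with hlt
  · rw [intervalIntegral_abs_sub_rpow_eq_toReal,
      lintegral_abs_sub_rpow_of_abs_lt_one (by linarith) (by linarith) hlt, hbeta,
      ENNReal.toReal_ofReal hcα.le]
  · have hgt : 1 < |x| := lt_of_le_of_ne (not_lt.1 hlt) (Ne.symm hx)
    have hfold : ∫ y in (-1 : ℝ)..1, |x - y| ^ (α - 1 - 1) * (1 - y ^ 2) ^ (-((α - 1) / 2)) =
        ∫ y in (-1 : ℝ)..1, |(|x| - y)| ^ (α - 1 - 1) * (1 - y ^ 2) ^ (-((α - 1) / 2)) := by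
      rcases abs_choice x with h | h <;> rw [h]
      rw [integral_abs_sub_rpow_neg]
    rw [hfold, integral_abs_sub_rpow_of_one_lt (by linarith) hgt, hCbeta, hsum]
    ring
end
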